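/- arXiv:2605.29781 — 2 statements merged into one kernel-verified Lean document; each statement's English description precedes it below -/
import Mathlib

section
/- (L⁴ bound for spectral clusters from a single λ.) For every ε ∈ (0,1) there exists C_ε > 0 such that for every λ ∈ ℤ∖{0}, every ℓ ∈ ℕ and every γ : ℤ/λℤ → ℂ, setting μ = √(2π|λ|(2ℓ+1)), one has (∫_{[0,1]³} |∑_{q∈ℤ/λℤ} γ(q) h_{λ,q,ℓ}(a,b,c)|⁴ da db dc)^{1/4} ≤ C_ε · μ^{(1+ε)/2} · (∑_{q∈ℤ/λℤ} |γ(q)|²)^{1/2}. -/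
open MeasureTheory Real Complex
open scoped ComplexConjugate

/-- Physicists' Hermite polynomial `H_ℓ(u) = (-1)^ℓ e^{u²} (d/du)^ℓ e^{-u²}`. -/
noncomputable def hermitePoly (ℓ : ℕ) (u : ℝ) : ℝ :=
  (-1 : ℝ) ^ ℓ * Real.exp (u ^ 2) * iteratedDeriv ℓ (fun t : ℝ => Real.exp (-t ^ 2)) u

/-- Normalised Hermite function `h_ℓ(u) = (√π 2^ℓ ℓ!)^{-1/2} H_ℓ(u) e^{-u²/2}`. -/
noncomputable def hermiteFun (ℓ : ℕ) (u : ℝ) : ℝ :=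
  (Real.sqrt π * 2 ^ ℓ * (ℓ.factorial : ℝ)) ^ (-(1 : ℝ) / 2) *
    hermitePoly ℓ u * Real.exp (-u ^ 2 / 2)

/-- Rescaled Hermite function `h_{ℓ,λ}(u) = (2π|λ|)^{1/4} h_ℓ(√(2π|λ|) u)`. -/
noncomputable def hermiteScaled (ℓ : ℕ) (lam : ℤ) (u : ℝ) : ℝ :=
  (2 * π * |(lam : ℝ)|) ^ ((1 : ℝ) / 4) * hermiteFun ℓ (Real.sqrt (2 * π * |(lam : ℝ)|) * u)

/-- The generalised Berezin–Weil–Zak transform. -/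
noncomputable def BWZ (lam q : ℤ) (h : ℝ → ℂ) (x : ℝ × ℝ × ℝ) : ℂ :=
  ((Real.sqrt |(lam : ℝ)| : ℝ) / (lam : ℝ) : ℝ) *
    ∑' k : ℤ, Complex.exp (-(2 * (π : ℂ) * Complex.I * (q : ℂ) * (k : ℂ)) / (lam : ℂ)) *
      Complex.exp (2 * (π : ℂ) * Complex.I * ((lam : ℂ) * (x.2.2 : ℂ) + (k : ℂ) * (x.2.1 : ℂ))) *
      h ((k : ℝ) / (lam : ℝ) + x.1)

/-- The eigenfunctions `h_{λ,q,ℓ} = BWZ_{λ,q}(h_{ℓ,λ})`. -/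
noncomputable def hBWZ (lam q : ℤ) (ℓ : ℕ) : ℝ × ℝ × ℝ → ℂ :=
  BWZ lam q (fun u => (hermiteScaled ℓ lam u : ℂ))

/-- The Hermite polynomials, defined by the raising recurrence. -/
noncomputable def hermitePolynomial : ℕ → Polynomial ℝ
  | 0 => 1
  | n + 1 => 2 * Polynomial.X * hermitePolynomial n - Polynomial.derivative (hermitePolynomial n)

lemma hermitePolynomial_succ (n : ℕ) : hermitePolynomial (n + 1) =
    2 * Polynomial.X * hermitePolynomial n - Polynomial.derivative (hermitePolynomial n) := rfl

lemma derivative_hermitePolynomial_succ (n : ℕ) :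
    Polynomial.derivative (hermitePolynomial (n + 1)) = 2 * (n + 1) * hermitePolynomial n := by
  induction n with
  | zero => simp [hermitePolynomial]
  | succ n ih =>
    rw [hermitePolynomial_succ (n + 1), Polynomial.derivative_sub, Polynomial.derivative_mul, ih,
      hermitePolynomial_succ n]
    have h1 : (n : Polynomial ℝ) + 1 = ((n + 1 : ℕ) : Polynomial ℝ) := by push_cast; ring
    have h2 : Polynomial.derivative (2 * ((n : Polynomial ℝ) + 1) * hermitePolynomial n) =
        2 * ((n : Polynomial ℝ) + 1) * Polynomial.derivative (hermitePolynomial n) := by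
      rw [h1, Polynomial.derivative_mul]; simp
    have h3 : Polynomial.derivative (2 * Polynomial.X : Polynomial ℝ) = 2 := by simp
    rw [h2, h3]
    push_cast
    ring

lemma derivative_hermitePolynomial (n : ℕ) :
    Polynomial.derivative (hermitePolynomial n) = 2 * n * hermitePolynomial (n - 1) := by
  cases n with
  | zero => simp [hermitePolynomial]
  | succ n => rw [derivative_hermitePolynomial_succ]; simp

lemma hasDerivAt_polynomial_mul_gaussian (P : Polynomial ℝ) (b x : ℝ) :
    HasDerivAt (fun t => P.eval t * Real.exp (-b * t ^ 2))
      ((Polynomial.derivative P - 2 * Polynomial.C b * Polynomial.X * P).eval x *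
        Real.exp (-b * x ^ 2)) x := by
  have h := (P.hasDerivAt x).mul (((hasDerivAt_pow 2 x).const_mul (-b)).exp)
  refine h.congr_deriv ?_
  simp
  ring

lemma integrable_polynomial_mul_gaussian (P : Polynomial ℝ) {b : ℝ} (hb : 0 < b) :
    Integrable (fun t => P.eval t * Real.exp (-b * t ^ 2)) := by
  induction P using Polynomial.induction_on' with
  | add p q hp hq =>
    simp only [Polynomial.eval_add, add_mul]
    exact hp.add hq
  | monomial n a =>
    have h := (integrable_rpow_mul_exp_neg_mul_sq hb
      (s := n) (by have : (0 : ℝ) ≤ n := n.cast_nonneg; linarith)).const_mul a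
    simpa [mul_assoc] using h

lemma iteratedDeriv_gaussian (n : ℕ) (u : ℝ) :
    iteratedDeriv n (fun t : ℝ => Real.exp (-t ^ 2)) u =
      (-1) ^ n * (hermitePolynomial n).eval u * Real.exp (-1 * u ^ 2) := by
  induction n generalizing u with
  | zero => simp [hermitePolynomial]
  | succ n ih =>
    rw [iteratedDeriv_succ, funext ih]
    have h := ((hasDerivAt_polynomial_mul_gaussian (hermitePolynomial n) 1 u).const_mul ((-1) ^ n)).deriv
    simp only [← mul_assoc] at h
    rw [h, hermitePolynomial_succ]
    simp
    ring

/-- The Hermite functions `H_n(t) e^{-t²/2}` without normalisation. -/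
noncomputable def hermitePsi (n : ℕ) (t : ℝ) : ℝ :=
  (hermitePolynomial n).eval t * Real.exp (-(1 / 2) * t ^ 2)

lemma hermiteFun_eq (n : ℕ) (u : ℝ) :
    hermiteFun n u = (Real.sqrt π * 2 ^ n * (n.factorial : ℝ)) ^ (-(1 : ℝ) / 2) * hermitePsi n u := by
  rw [hermiteFun, hermitePoly, iteratedDeriv_gaussian, hermitePsi]
  have h1 : ((-1 : ℝ) ^ n) * (-1) ^ n = 1 := by rw [← mul_pow]; simp
  have h2 : Real.exp (u ^ 2) * Real.exp (-1 * u ^ 2) = 1 := by rw [← Real.exp_add]; simp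
  have h3 : -u ^ 2 / 2 = -(1 / 2) * u ^ 2 := by ring
  rw [h3]
  linear_combination
    ((Real.sqrt π * 2 ^ n * (n.factorial : ℝ)) ^ (-(1 : ℝ) / 2)
      * (hermitePolynomial n).eval u * Real.exp (-(1 / 2) * u ^ 2)) *
      (h1 * (Real.exp (u ^ 2) * Real.exp (-1 * u ^ 2)) + h2)

lemma mul_hermitePsi (n : ℕ) (t : ℝ) :
    t * hermitePsi n t = n * hermitePsi (n - 1) t + hermitePsi (n + 1) t / 2 := by
  have h := congrArg (Polynomial.eval t) (derivative_hermitePolynomial n)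
  simp only [hermitePsi, hermitePolynomial_succ]
  simp at h ⊢
  rw [h]
  ring

/-- The derivative of `hermitePsi n`. -/
noncomputable def hermitePsiDeriv (n : ℕ) (t : ℝ) : ℝ :=
  n * hermitePsi (n - 1) t - hermitePsi (n + 1) t / 2

lemma hasDerivAt_hermitePsi (n : ℕ) (t : ℝ) :
    HasDerivAt (hermitePsi n) (hermitePsiDeriv n t) t := by
  refine (hasDerivAt_polynomial_mul_gaussian (hermitePolynomial n) (1 / 2) t).congr_deriv ?_
  have h := congrArg (Polynomial.eval t) (derivative_hermitePolynomial n)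
  simp only [hermitePsiDeriv, hermitePsi, hermitePolynomial_succ]
  simp at h ⊢
  rw [h]
  ring

lemma continuous_hermitePsi (n : ℕ) : Continuous (hermitePsi n) :=
  continuous_iff_continuousAt.2 fun t => (hasDerivAt_hermitePsi n t).continuousAt

lemma continuous_hermitePsiDeriv (n : ℕ) : Continuous (hermitePsiDeriv n) := by
  have h1 := continuous_hermitePsi (n - 1)
  have h2 := continuous_hermitePsi (n + 1)
  unfold hermitePsiDeriv
  fun_prop

lemma integrable_hermitePsi_sq (n : ℕ) : Integrable (fun t => hermitePsi n t ^ 2) := by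
  refine (integrable_polynomial_mul_gaussian (hermitePolynomial n ^ 2) one_pos).congr
    (Filter.Eventually.of_forall fun t => ?_)
  simp only [hermitePsi, Polynomial.eval_pow, mul_pow, ← Real.exp_nat_mul]
  congr 2
  push_cast
  ring

lemma integral_hermitePsi_sq (n : ℕ) :
    ∫ t, hermitePsi n t ^ 2 = Real.sqrt π * 2 ^ n * (n.factorial : ℝ) := by
  have key : ∀ n (t : ℝ), hermitePsi n t ^ 2 =
      (hermitePolynomial n ^ 2).eval t * Real.exp (-1 * t ^ 2) := by
    intro n t
    simp only [hermitePsi, Polynomial.eval_pow, mul_pow, ← Real.exp_nat_mul]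
    congr 2
    push_cast
    ring
  induction n with
  | zero =>
    simp_rw [key]
    simpa [hermitePolynomial] using integral_gaussian 1
  | succ n ih =>
    have h := integral_mul_deriv_eq_deriv_mul_of_integrable
      (u := fun t => (hermitePolynomial (n + 1)).eval t)
      (v := fun t => (hermitePolynomial n).eval t * Real.exp (-1 * t ^ 2))
      (u' := fun t => (Polynomial.derivative (hermitePolynomial (n + 1))).eval t)
      (v' := fun t => ((Polynomial.derivative (hermitePolynomial n) -
        2 * Polynomial.C 1 * Polynomial.X * hermitePolynomial n)).eval t * Real.exp (-1 * t ^ 2))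
      (fun x _ => Polynomial.hasDerivAt _ x)
      (fun x _ => hasDerivAt_polynomial_mul_gaussian _ _ x)
      (by
        convert! integrable_polynomial_mul_gaussian (hermitePolynomial (n + 1) *
          (Polynomial.derivative (hermitePolynomial n) -
        2 * Polynomial.C 1 * Polynomial.X * hermitePolynomial n)) one_pos using 2
        simp [mul_assoc])
      (by
        convert! integrable_polynomial_mul_gaussian
          (Polynomial.derivative (hermitePolynomial (n + 1)) * hermitePolynomial n) one_pos using 2
        simp [mul_assoc])
      (by
        convert! integrable_polynomial_mul_gaussian
          (hermitePolynomial (n + 1) * hermitePolynomial n) one_pos using 2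
        simp [mul_assoc])
    have e1 : ∀ t : ℝ, (hermitePolynomial (n + 1)).eval t *
        (((Polynomial.derivative (hermitePolynomial n) -
        2 * Polynomial.C 1 * Polynomial.X * hermitePolynomial n)).eval t * Real.exp (-1 * t ^ 2)) =
        - hermitePsi (n + 1) t ^ 2 := by
      intro t
      rw [key, Polynomial.eval_pow, sq, hermitePolynomial_succ]
      simp
      ring
    have e2 : ∀ t : ℝ, (Polynomial.derivative (hermitePolynomial (n + 1))).eval t *
        ((hermitePolynomial n).eval t * Real.exp (-1 * t ^ 2)) =
        2 * (n + 1) * hermitePsi n t ^ 2 := by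
      intro t
      rw [key, Polynomial.eval_pow, sq, derivative_hermitePolynomial_succ]
      simp
      ring
    simp_rw [e1, e2, integral_neg, integral_const_mul] at h
    rw [ih] at h
    rw [neg_inj.1 h, Nat.factorial_succ]
    push_cast
    ring

lemma sq_combination_le (a b c : ℝ) (n : ℝ) :
    (n * a + c * b / 2) ^ 2 ≤ 2 * n ^ 2 * a ^ 2 + c ^ 2 * b ^ 2 / 2 := by
  nlinarith [sq_nonneg (n * a - c * b / 2)]

/-- The mass `∫ ψ_n²`. -/
noncomputable def hermiteMass (n : ℕ) : ℝ := Real.sqrt π * 2 ^ n * (n.factorial : ℝ)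

lemma hermiteMass_pos (n : ℕ) : 0 < hermiteMass n := by
  unfold hermiteMass
  have := Real.pi_pos
  positivity

lemma hermiteMass_succ (n : ℕ) : hermiteMass (n + 1) = 2 * (n + 1) * hermiteMass n := by
  unfold hermiteMass
  rw [Nat.factorial_succ]
  push_cast
  ring

lemma sq_mul_hermiteMass_pred (n : ℕ) :
    2 * (n : ℝ) ^ 2 * hermiteMass (n - 1) = n * hermiteMass n := by
  cases n with
  | zero => simp
  | succ n =>
    rw [hermiteMass_succ]
    simp
    ring

/-- If two square-integrable families are combined as in the ladder relations, the square of the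
combination is integrable with the expected bound. -/
lemma integral_sq_ladder_le {u f g : ℝ → ℝ} (hu : Continuous u)
    (hf : Integrable (fun t => f t ^ 2)) (hg : Integrable (fun t => g t ^ 2)) (n c : ℝ)
    (hc : c ^ 2 = 1) (h : ∀ t, u t = n * f t + c * g t / 2) :
    Integrable (fun t => u t ^ 2) ∧
      ∫ t, u t ^ 2 ≤ 2 * n ^ 2 * (∫ t, f t ^ 2) + (∫ t, g t ^ 2) / 2 := by
  have hle : ∀ t, u t ^ 2 ≤ 2 * n ^ 2 * f t ^ 2 + g t ^ 2 / 2 := by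
    intro t
    have := sq_combination_le (f t) (g t) c n
    rw [hc, one_mul] at this
    rwa [h t]
  have hI : Integrable (fun t => 2 * n ^ 2 * f t ^ 2 + g t ^ 2 / 2) :=
    (hf.const_mul _).add (hg.div_const _)
  have hui : Integrable (fun t => u t ^ 2) :=
    hI.mono' (hu.pow 2).aestronglyMeasurable (Filter.Eventually.of_forall fun t => by
      rw [Real.norm_of_nonneg (sq_nonneg _)]; exact hle t)
  refine ⟨hui, (integral_mono hui hI hle).trans_eq ?_⟩
  rw [integral_add (hf.const_mul _) (hg.div_const _), integral_const_mul, integral_div]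

lemma integral_hermitePsiDeriv_sq_le (n : ℕ) :
    Integrable (fun t => hermitePsiDeriv n t ^ 2) ∧
      ∫ t, hermitePsiDeriv n t ^ 2 ≤ (2 * n + 1) * hermiteMass n := by
  obtain ⟨h1, h2⟩ := integral_sq_ladder_le (continuous_hermitePsiDeriv n)
    (integrable_hermitePsi_sq (n - 1)) (integrable_hermitePsi_sq (n + 1)) n (-1) (by norm_num)
    (fun t => by unfold hermitePsiDeriv; ring)
  refine ⟨h1, h2.trans_eq ?_⟩
  rw [integral_hermitePsi_sq, integral_hermitePsi_sq]
  change 2 * (n : ℝ) ^ 2 * hermiteMass (n - 1) + hermiteMass (n + 1) / 2 = _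
  rw [sq_mul_hermiteMass_pred, hermiteMass_succ]
  ring

lemma integral_mul_hermitePsi_sq_le (n : ℕ) :
    Integrable (fun t => (t * hermitePsi n t) ^ 2) ∧
      ∫ t, (t * hermitePsi n t) ^ 2 ≤ (2 * n + 1) * hermiteMass n := by
  obtain ⟨h1, h2⟩ := integral_sq_ladder_le (continuous_id.mul (continuous_hermitePsi n))
    (integrable_hermitePsi_sq (n - 1)) (integrable_hermitePsi_sq (n + 1)) n 1 (by norm_num)
    (fun t => by simpa using mul_hermitePsi n t)
  refine ⟨h1, h2.trans_eq ?_⟩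
  rw [integral_hermitePsi_sq, integral_hermitePsi_sq]
  change 2 * (n : ℝ) ^ 2 * hermiteMass (n - 1) + hermiteMass (n + 1) / 2 = _
  rw [sq_mul_hermiteMass_pred, hermiteMass_succ]
  ring

lemma hasDerivAt_mul_hermitePsi (n : ℕ) (t : ℝ) :
    HasDerivAt (fun t => t * hermitePsi n t)
      (n * hermitePsiDeriv (n - 1) t + 1 * hermitePsiDeriv (n + 1) t / 2) t := by
  rw [funext (mul_hermitePsi n), one_mul]
  exact ((hasDerivAt_hermitePsi (n - 1) t).const_mul _).add
    ((hasDerivAt_hermitePsi (n + 1) t).div_const 2)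

lemma integral_deriv_mul_hermitePsi_sq_le (n : ℕ) :
    Integrable (fun t =>
      (n * hermitePsiDeriv (n - 1) t + 1 * hermitePsiDeriv (n + 1) t / 2) ^ 2) ∧
      ∫ t, (n * hermitePsiDeriv (n - 1) t + 1 * hermitePsiDeriv (n + 1) t / 2) ^ 2 ≤
        3 * (2 * n + 1) ^ 2 * hermiteMass n := by
  obtain ⟨h1, h1'⟩ := integral_hermitePsiDeriv_sq_le (n - 1)
  obtain ⟨h2, h2'⟩ := integral_hermitePsiDeriv_sq_le (n + 1)
  have c1 := continuous_hermitePsiDeriv (n - 1)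
  have c2 := continuous_hermitePsiDeriv (n + 1)
  obtain ⟨h3, h4⟩ := integral_sq_ladder_le
    (u := fun t => n * hermitePsiDeriv (n - 1) t + 1 * hermitePsiDeriv (n + 1) t / 2)
    (by fun_prop) h1 h2 n 1 (by norm_num) (fun t => rfl)
  refine ⟨h3, h4.trans ?_⟩
  have hm := hermiteMass_pos n
  have e : 2 * (n : ℝ) ^ 2 * ((2 * ((n - 1 : ℕ) : ℝ) + 1) * hermiteMass (n - 1)) ≤
      (2 * n + 1) * (n * hermiteMass n) := by
    rw [← sq_mul_hermiteMass_pred]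
    have h0 := (hermiteMass_pos (n - 1)).le
    have h5 : ((n - 1 : ℕ) : ℝ) ≤ n := by exact_mod_cast Nat.sub_le n 1
    have : 0 ≤ 2 * (n : ℝ) ^ 2 * hermiteMass (n - 1) := by positivity
    nlinarith
  have e2 : 2 * (n : ℝ) ^ 2 * ∫ t, hermitePsiDeriv (n - 1) t ^ 2 ≤
      (2 * n + 1) * (n * hermiteMass n) :=
    (mul_le_mul_of_nonneg_left h1' (by positivity)).trans e
  rw [hermiteMass_succ] at h2'
  push_cast at h2'
  have hn : (0 : ℝ) ≤ n := n.cast_nonneg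
  have : 0 ≤ (n : ℝ) * hermiteMass n := by positivity
  have : 0 ≤ (n : ℝ) ^ 2 * hermiteMass n := by positivity
  nlinarith

lemma hermiteFun_sq (n : ℕ) (t : ℝ) : hermiteFun n t ^ 2 = hermitePsi n t ^ 2 / hermiteMass n := by
  rw [hermiteFun_eq, mul_pow]
  change (hermiteMass n ^ (-(1 : ℝ) / 2)) ^ 2 * _ = _
  rw [← Real.rpow_natCast, ← Real.rpow_mul (hermiteMass_pos n).le]
  norm_num
  rw [Real.rpow_neg_one]
  field_simp

lemma continuous_hermiteFun (n : ℕ) : Continuous (hermiteFun n) := by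
  rw [funext (hermiteFun_eq n)]
  exact continuous_const.mul (continuous_hermitePsi n)

lemma integrable_hermiteFun_sq (n : ℕ) : Integrable (fun t => hermiteFun n t ^ 2) := by
  simp only [hermiteFun_sq]
  exact (integrable_hermitePsi_sq n).div_const _

lemma integral_hermiteFun_sq (n : ℕ) : ∫ t, hermiteFun n t ^ 2 = 1 := by
  simp only [hermiteFun_sq]
  rw [integral_div, integral_hermitePsi_sq]
  exact div_self (hermiteMass_pos n).ne'

/-- The weighted density `(1 + t² / (2n+1)) h_n(t)²` has mass `O(1)`, and its derivative has
`L¹` norm `O(√(2n+1))`. -/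
lemma exists_deriv_weighted_hermiteFun_sq (n : ℕ) :
    ∃ f' : ℝ → ℝ,
      (∀ t, HasDerivAt (fun t => (1 + (t / √(2 * n + 1)) ^ 2) * hermiteFun n t ^ 2) (f' t) t) ∧
      Continuous f' ∧
      Integrable (fun t => (1 + (t / √(2 * n + 1)) ^ 2) * hermiteFun n t ^ 2) ∧ Integrable f' ∧
      ∫ t, |(1 + (t / √(2 * n + 1)) ^ 2) * hermiteFun n t ^ 2| ≤ 2 ∧
      ∫ t, |f' t| ≤ 6 * √(2 * n + 1) := by
  have hL : (0 : ℝ) < 2 * n + 1 := by positivity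
  set r := √(2 * (n : ℝ) + 1) with hr
  have hr0 : 0 < r := Real.sqrt_pos.2 hL
  have hr2 : r ^ 2 = 2 * n + 1 := Real.sq_sqrt hL.le
  have hm := hermiteMass_pos n
  set m := hermiteMass n with hmdef
  set g' : ℝ → ℝ := fun t => n * hermitePsiDeriv (n - 1) t + 1 * hermitePsiDeriv (n + 1) t / 2
    with hg'
  have hg'c : Continuous g' := by
    have c1 := continuous_hermitePsiDeriv (n - 1)
    have c2 := continuous_hermitePsiDeriv (n + 1)
    fun_prop
  have c3 := continuous_hermitePsi n
  have c4 := continuous_hermitePsiDeriv n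
  obtain ⟨i1, b1⟩ := integral_hermitePsiDeriv_sq_le n
  obtain ⟨i2, b2⟩ := integral_mul_hermitePsi_sq_le n
  obtain ⟨i3, b3⟩ := integral_deriv_mul_hermitePsi_sq_le n
  have i0 := integrable_hermitePsi_sq n
  have b0 : ∫ t, hermitePsi n t ^ 2 = m := integral_hermitePsi_sq n
  change Integrable (fun t => g' t ^ 2) at i3
  change ∫ t, g' t ^ 2 ≤ _ at b3
  rw [← hr2, ← hmdef] at b1 b2 b3
  have hrw : ∀ t, (1 + (t / r) ^ 2) * hermiteFun n t ^ 2 =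
      m⁻¹ * (hermitePsi n t ^ 2 + (r ^ 2)⁻¹ * (t * hermitePsi n t) ^ 2) := by
    intro t
    rw [hermiteFun_sq, ← hmdef]
    field_simp
  simp only [hrw]
  have hF : Integrable (fun t =>
      m⁻¹ * (hermitePsi n t ^ 2 + (r ^ 2)⁻¹ * (t * hermitePsi n t) ^ 2)) :=
    (i0.add (i2.const_mul _)).const_mul _
  set f' : ℝ → ℝ := fun t => m⁻¹ * (2 * hermitePsi n t * hermitePsiDeriv n t +
    (r ^ 2)⁻¹ * (2 * (t * hermitePsi n t) * g' t)) with hf'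
  have hf'c : Continuous f' := by fun_prop
  set D : ℝ → ℝ := fun t => m⁻¹ * ((r * hermitePsi n t ^ 2 + r⁻¹ * hermitePsiDeriv n t ^ 2) +
    (r ^ 2)⁻¹ * (r * (t * hermitePsi n t) ^ 2 + r⁻¹ * g' t ^ 2)) with hD
  have am : ∀ x y : ℝ, |2 * x * y| ≤ r * x ^ 2 + r⁻¹ * y ^ 2 := by
    intro x y
    rw [abs_le]
    constructor
    · have : r * x ^ 2 + r⁻¹ * y ^ 2 + 2 * x * y = r⁻¹ * (r * x + y) ^ 2 := by field_simp; ring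
      have : 0 ≤ r⁻¹ * (r * x + y) ^ 2 := by positivity
      linarith
    · have : r * x ^ 2 + r⁻¹ * y ^ 2 - 2 * x * y = r⁻¹ * (r * x - y) ^ 2 := by field_simp; ring
      have : 0 ≤ r⁻¹ * (r * x - y) ^ 2 := by positivity
      linarith
  have hle : ∀ t, |f' t| ≤ D t := by
    intro t
    simp only [hf', hD]
    rw [abs_mul, abs_of_pos (inv_pos.2 hm)]
    refine mul_le_mul_of_nonneg_left ((abs_add_le _ _).trans (add_le_add (am _ _) ?_))
      (inv_pos.2 hm).le
    rw [abs_mul, abs_of_pos (by positivity : 0 < (r ^ 2)⁻¹)]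
    exact mul_le_mul_of_nonneg_left (am _ _) (by positivity)
  have hDi : Integrable D :=
    (((i0.const_mul r).add (i1.const_mul r⁻¹)).add
      (((i2.const_mul r).add (i3.const_mul r⁻¹)).const_mul _)).const_mul _
  have hf'i : Integrable f' :=
    hDi.mono' hf'c.aestronglyMeasurable (Filter.Eventually.of_forall hle)
  refine ⟨f', fun t => ?_, hf'c, hF, hf'i, ?_, ?_⟩
  · have d1 := (hasDerivAt_hermitePsi n t).pow 2
    have d2 := ((hasDerivAt_mul_hermitePsi n t).pow 2).const_mul (r ^ 2)⁻¹
    refine ((d1.add d2).const_mul m⁻¹).congr_deriv ?_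
    simp [hf', hg']
  · have e : ∀ t, |m⁻¹ * (hermitePsi n t ^ 2 + (r ^ 2)⁻¹ * (t * hermitePsi n t) ^ 2)| =
        m⁻¹ * (hermitePsi n t ^ 2 + (r ^ 2)⁻¹ * (t * hermitePsi n t) ^ 2) := fun t =>
      abs_of_nonneg (by positivity)
    simp only [e]
    rw [integral_const_mul, integral_add i0 (i2.const_mul _), integral_const_mul, b0]
    have h1 : (r ^ 2)⁻¹ * ∫ t, (t * hermitePsi n t) ^ 2 ≤ m :=
      (mul_le_mul_of_nonneg_left b2 (by positivity)).trans_eq (by field_simp)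
    calc m⁻¹ * (m + (r ^ 2)⁻¹ * ∫ t, (t * hermitePsi n t) ^ 2) ≤ m⁻¹ * (m + m) := by gcongr
      _ = 2 := by field_simp; norm_num
  · refine (integral_mono hf'i.abs hDi hle).trans ?_
    simp only [hD]
    have j1 : Integrable (fun t => r * hermitePsi n t ^ 2 + r⁻¹ * hermitePsiDeriv n t ^ 2) :=
      (i0.const_mul r).add (i1.const_mul r⁻¹)
    have j2 : Integrable (fun t => r * (t * hermitePsi n t) ^ 2 + r⁻¹ * g' t ^ 2) :=
      (i2.const_mul r).add (i3.const_mul r⁻¹)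
    rw [integral_const_mul, integral_add j1 (j2.const_mul _), integral_const_mul (r ^ 2)⁻¹,
      integral_add (i0.const_mul r) (i1.const_mul r⁻¹),
      integral_add (i2.const_mul r) (i3.const_mul r⁻¹)]
    simp only [integral_const_mul]
    rw [b0]
    calc _ ≤ m⁻¹ * ((r * m + r⁻¹ * (r ^ 2 * m)) +
          (r ^ 2)⁻¹ * (r * (r ^ 2 * m) + r⁻¹ * (3 * (r ^ 2) ^ 2 * m))) := by gcongr
      _ = 6 * r := by field_simp; ring

/-- A Sobolev-type bound for sums over integer translates. -/
lemma tsum_abs_int_translate_le {f f' : ℝ → ℝ} (hf : ∀ x, HasDerivAt f (f' x) x)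
    (hf' : Continuous f') (hfi : Integrable f) (hfi' : Integrable f') (x : ℝ) :
    Summable (fun n : ℤ => |f (x + n)|) ∧
      ∑' n : ℤ, |f (x + n)| ≤ (∫ t, |f t|) + ∫ t, |f' t| := by
  have hc : Continuous f := continuous_iff_continuousAt.2 fun t => (hf t).continuousAt
  have hI : Integrable (fun t => |f t| + |f' t|) := hfi.abs.add hfi'.abs
  have hs := hI.hasSum_intervalIntegral x
  have key : ∀ n : ℤ, |f (x + n)| ≤ ∫ t in (x + n)..(x + n + 1), (|f t| + |f' t|) := by
    intro n
    set y := x + n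
    have h1 : ∀ t ∈ Set.Icc y (y + 1), |f y| ≤ |f t| + ∫ s in y..(y + 1), |f' s| := by
      intro t ht
      have h2 : ∫ s in y..t, f' s = f t - f y :=
        intervalIntegral.integral_eq_sub_of_hasDerivAt (fun s _ => hf s)
          (hf'.intervalIntegrable _ _)
      have h3 : |∫ s in y..t, f' s| ≤ ∫ s in y..t, |f' s| :=
        intervalIntegral.abs_integral_le_integral_abs ht.1
      have h4 : ∫ s in y..t, |f' s| ≤ ∫ s in y..(y + 1), |f' s| :=
        intervalIntegral.integral_mono_interval (μ := volume) le_rfl ht.1 ht.2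
          (Filter.Eventually.of_forall fun s => abs_nonneg _) (hf'.abs.intervalIntegrable _ _)
      rw [h2] at h3
      have h5 := abs_sub_abs_le_abs_sub (f y) (f t)
      rw [abs_sub_comm] at h5
      linarith
    have h6 := intervalIntegral.integral_mono_on (μ := volume) (a := y) (b := y + 1) (by linarith)
      (continuous_const.intervalIntegrable _ _)
      ((hc.abs.add continuous_const).intervalIntegrable _ _) h1
    simp only [Pi.add_apply] at h6
    rw [intervalIntegral.integral_add (hc.abs.intervalIntegrable _ _)
      (continuous_const.intervalIntegrable _ _)] at h6
    rw [intervalIntegral.integral_add (hc.abs.intervalIntegrable _ _)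
      (hf'.abs.intervalIntegrable _ _)]
    simpa using h6
  have hsum : Summable (fun n : ℤ => |f (x + n)|) :=
    hs.summable.of_nonneg_of_le (fun n => abs_nonneg _) key
  refine ⟨hsum, (hsum.tsum_le_tsum key hs.summable).trans_eq ?_⟩
  rw [hs.tsum_eq, integral_add hfi.abs hfi'.abs]

/-- Sums over a rescaled and translated lattice `κ ℤ + a`. -/
lemma tsum_abs_lattice_le {f f' : ℝ → ℝ} (hf : ∀ x, HasDerivAt f (f' x) x)
    (hf' : Continuous f') (hfi : Integrable f) (hfi' : Integrable f') {κ : ℝ} (hκ : κ ≠ 0) (a : ℝ) :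
    Summable (fun n : ℤ => |f (κ * n + a)|) ∧
      ∑' n : ℤ, |f (κ * n + a)| ≤ |κ|⁻¹ * (∫ t, |f t|) + ∫ t, |f' t| := by
  have hi : ∀ {g : ℝ → ℝ}, Integrable g → Integrable (fun t => g (κ * t + a)) := fun hg =>
    (hg.comp_add_right a).comp_mul_left' hκ
  have hint : ∀ g : ℝ → ℝ, ∫ t, g (κ * t + a) = |κ|⁻¹ * ∫ t, g t := by
    intro g
    rw [Measure.integral_comp_mul_left (fun t => g (t + a)) κ, integral_add_right_eq_self g a,
      abs_inv, smul_eq_mul]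
  have h := tsum_abs_int_translate_le (f := fun t => f (κ * t + a))
    (f' := fun t => κ * f' (κ * t + a)) (fun x => by
      have h1 : HasDerivAt (fun t => κ * t + a) κ x := by
        simpa using ((hasDerivAt_id x).const_mul κ).add_const a
      simpa [mul_comm, Function.comp_def] using (hf (κ * x + a)).comp x h1) (by fun_prop) (hi hfi)
      ((hi hfi').const_mul κ) 0
  simp only [zero_add, abs_mul, integral_const_mul] at h
  rw [hint (fun t => |f t|), hint (fun t => |f' t|), ← mul_assoc,
    mul_inv_cancel₀ (abs_ne_zero.2 hκ), one_mul] at h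
  exact h

lemma tsum_inv_one_add_sq_le {κ : ℝ} (hκ : 0 < κ) (x : ℝ) :
    Summable (fun n : ℤ => (1 + (κ * (x + n)) ^ 2)⁻¹) ∧
      ∑' n : ℤ, (1 + (κ * (x + n)) ^ 2)⁻¹ ≤ π * (κ⁻¹ + 1) := by
  have hpos : ∀ t : ℝ, 0 < 1 + t ^ 2 := fun t => by positivity
  have hd : ∀ t : ℝ, HasDerivAt (fun t : ℝ => (1 + t ^ 2)⁻¹) (-(2 * t) / (1 + t ^ 2) ^ 2) t := by
    intro t
    have h1 : HasDerivAt (fun t : ℝ => 1 + t ^ 2) (2 * t) t := by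
      simpa using (hasDerivAt_pow 2 t).const_add 1
    exact h1.inv (hpos t).ne'
  have hc : Continuous (fun t : ℝ => -(2 * t) / (1 + t ^ 2) ^ 2) := by
    refine Continuous.div (by fun_prop) (by fun_prop) fun t => ?_
    exact pow_ne_zero _ (hpos t).ne'
  have hle : ∀ t : ℝ, |-(2 * t) / (1 + t ^ 2) ^ 2| ≤ (1 + t ^ 2)⁻¹ := by
    intro t
    rw [abs_div, abs_neg, abs_of_pos (pow_pos (hpos t) 2), div_le_iff₀ (pow_pos (hpos t) 2),
      sq (1 + t ^ 2),
      ← mul_assoc, inv_mul_cancel₀ (hpos t).ne', one_mul, abs_mul, abs_two]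
    nlinarith [sq_nonneg (|t| - 1), sq_abs t]
  have hi' : Integrable (fun t : ℝ => -(2 * t) / (1 + t ^ 2) ^ 2) :=
    integrable_inv_one_add_sq.mono' hc.aestronglyMeasurable (Filter.Eventually.of_forall hle)
  obtain ⟨h1, h2⟩ := tsum_abs_lattice_le hd hc integrable_inv_one_add_sq hi' hκ.ne' (κ * x)
  have e : ∀ n : ℤ, |(1 + (κ * (n : ℝ) + κ * x) ^ 2)⁻¹| = (1 + (κ * (x + n)) ^ 2)⁻¹ := by
    intro n
    rw [abs_of_pos (inv_pos.2 (hpos _))]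
    ring_nf
  simp only [e] at h1 h2
  refine ⟨h1, h2.trans ?_⟩
  have h3 : ∫ t : ℝ, |(1 + t ^ 2)⁻¹| = π := by
    rw [← integral_univ_inv_one_add_sq]
    exact integral_congr_ae (Filter.Eventually.of_forall fun t => abs_of_pos (inv_pos.2 (hpos t)))
  have h4 : ∫ t : ℝ, |-(2 * t) / (1 + t ^ 2) ^ 2| ≤ π := by
    rw [← integral_univ_inv_one_add_sq]
    exact integral_mono hi'.abs integrable_inv_one_add_sq hle
  rw [h3, abs_of_pos hκ]
  linarith

lemma sum_fin_eq_sum_zmod {N : ℕ} [NeZero N] (w : ZMod N → ℝ) :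
    ∑ r : Fin N, w ((r : ℕ) : ZMod N) = ∑ r, w r := by
  cases N with
  | zero => exact (NeZero.ne 0 rfl).elim
  | succ n =>
    refine Finset.sum_congr rfl fun r _ => ?_
    congr 1
    exact Fin.cast_val_eq_self r

/-- Summation of an `N`-periodic weight against translates by multiples of `1/λ`. -/
lemma tsum_periodic_mul_le {lam : ℤ} [NeZero lam.natAbs] (w : ZMod lam.natAbs → ℝ)
    (hw : ∀ r, 0 ≤ w r) {f : ℝ → ℝ} (hf0 : ∀ x, 0 ≤ f x) {B : ℝ}
    (hf : ∀ x, Summable (fun n : ℤ => f (x + n)) ∧ ∑' n : ℤ, f (x + n) ≤ B) (a : ℝ) :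
    Summable (fun k : ℤ => w (k : ZMod lam.natAbs) * f ((k : ℝ) / lam + a)) ∧
      ∑' k : ℤ, w (k : ZMod lam.natAbs) * f ((k : ℝ) / lam + a) ≤ B * ∑ r, w r := by
  have hlam : (lam : ℝ) ≠ 0 := by
    have := NeZero.ne lam.natAbs
    exact_mod_cast Int.natAbs_ne_zero.1 this
  have hsgn : ∀ x, Summable (fun n : ℤ => f (x + n * (lam.natAbs : ℝ) / lam)) ∧
      ∑' n : ℤ, f (x + n * (lam.natAbs : ℝ) / lam) ≤ B := by
    intro x
    rcases Int.natAbs_eq lam with h | h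
    · have e : (lam : ℝ) = (lam.natAbs : ℝ) := by
        rw [← Int.cast_natCast, ← h]
      have e2 : ∀ n : ℤ, (n : ℝ) * (lam.natAbs : ℝ) / lam = n := fun n => by
        rw [← e]; field_simp
      simpa only [e2] using hf x
    · have e : (lam : ℝ) = -(lam.natAbs : ℝ) := by
        rw [← Int.cast_natCast, ← Int.cast_neg, ← h]
      have e1 : (lam.natAbs : ℝ) = -lam := by rw [e, neg_neg]
      have e2 : ∀ n : ℤ, (n : ℝ) * (lam.natAbs : ℝ) / lam = ((-n : ℤ) : ℝ) := fun n => by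
        rw [e1]; push_cast; field_simp
      simp only [e2]
      obtain ⟨h1, h2⟩ := hf x
      refine ⟨(Equiv.neg ℤ).summable_iff.2 h1, ?_⟩
      rw [← (Equiv.neg ℤ).tsum_eq] at h2
      exact h2
  let E : Fin lam.natAbs × ℤ ≃ ℤ :=
    (Equiv.prodComm _ _).trans (Int.divModEquiv lam.natAbs).symm
  have hE : ∀ p : Fin lam.natAbs × ℤ, E p = p.2 * lam.natAbs + (p.1 : ℕ) := fun p => by
    simp [E, Int.divModEquiv]
  have hterm : ∀ p : Fin lam.natAbs × ℤ,
      w ((E p : ℤ) : ZMod lam.natAbs) * f (((E p : ℤ) : ℝ) / lam + a) =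
      w ((p.1 : ℕ) : ZMod lam.natAbs) *
        f ((((p.1 : ℕ) : ℝ) / lam + a) + p.2 * (lam.natAbs : ℝ) / lam) := by
    intro p
    rw [hE]
    congr 2
    · rw [Int.cast_add, Int.cast_mul, Int.cast_natCast, ZMod.natCast_self, mul_zero, zero_add,
        Int.cast_natCast]
    · rw [Int.cast_add, Int.cast_mul, Int.cast_natCast, Int.cast_natCast]
      ring
  have hs : Summable (fun p : Fin lam.natAbs × ℤ =>
      w ((E p : ℤ) : ZMod lam.natAbs) * f (((E p : ℤ) : ℝ) / lam + a)) := by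
    rw [summable_prod_of_nonneg fun p => mul_nonneg (hw _) (hf0 _)]
    refine ⟨fun r => ?_, Summable.of_finite⟩
    simp only [hterm]
    exact (hsgn _).1.mul_left _
  refine ⟨E.summable_iff.1 hs, ?_⟩
  rw [← E.tsum_eq, hs.tsum_prod, tsum_fintype]
  have hbij : ∑ r : Fin lam.natAbs, w ((r : ℕ) : ZMod lam.natAbs) = ∑ r, w r := by
    exact sum_fin_eq_sum_zmod w
  rw [← hbij, Finset.mul_sum]
  refine Finset.sum_le_sum fun r _ => ?_
  simp only [hterm]
  rw [tsum_mul_left, mul_comm B]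
  exact mul_le_mul_of_nonneg_left (hsgn _).2 (hw _)

lemma tsum_mul_sq_le {ι : Type*} {f g : ι → ℝ} (hf : ∀ i, 0 ≤ f i) (hg : ∀ i, 0 ≤ g i)
    (hf2 : Summable (fun i => f i ^ 2)) (hg2 : Summable (fun i => g i ^ 2)) :
    Summable (fun i => f i * g i) ∧
      (∑' i, f i * g i) ^ 2 ≤ (∑' i, f i ^ 2) * ∑' i, g i ^ 2 := by
  obtain ⟨h1, h2⟩ := Real.summable_and_inner_le_Lp_mul_Lq_tsum_of_nonneg
    Real.HolderConjugate.two_two hf hg (by simpa using hf2) (by simpa using hg2)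
  refine ⟨h1, ?_⟩
  simp only [Real.rpow_two, ← Real.sqrt_eq_rpow] at h2
  have h3 : 0 ≤ ∑' i, f i ^ 2 := tsum_nonneg fun i => sq_nonneg _
  have h4 : 0 ≤ ∑' i, g i ^ 2 := tsum_nonneg fun i => sq_nonneg _
  calc _ ≤ (√(∑' i, f i ^ 2) * √(∑' i, g i ^ 2)) ^ 2 :=
        pow_le_pow_left₀ (tsum_nonneg fun i => mul_nonneg (hf i) (hg i)) h2 2
    _ = _ := by rw [mul_pow, Real.sq_sqrt h3, Real.sq_sqrt h4]

/-- The frequency scale `√(2π|λ|)`. -/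
noncomputable def heisenbergScale (lam : ℤ) : ℝ := √(2 * π * |(lam : ℝ)|)

lemma heisenbergScale_sq (lam : ℤ) : heisenbergScale lam ^ 2 = 2 * π * |(lam : ℝ)| :=
  Real.sq_sqrt (by have := Real.pi_pos; positivity)

lemma heisenbergScale_pos {lam : ℤ} (h : lam ≠ 0) : 0 < heisenbergScale lam := by
  have := Real.pi_pos
  have : (lam : ℝ) ≠ 0 := by exact_mod_cast h
  exact Real.sqrt_pos.2 (by positivity)

lemma hermiteScaled_sq (n : ℕ) (lam : ℤ) (u : ℝ) :
    hermiteScaled n lam u ^ 2 =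
      heisenbergScale lam * hermiteFun n (heisenbergScale lam * u) ^ 2 := by
  have h0 : 0 ≤ 2 * π * |(lam : ℝ)| := by have := Real.pi_pos; positivity
  rw [hermiteScaled, mul_pow, ← Real.rpow_natCast, ← Real.rpow_mul h0, heisenbergScale,
    Real.sqrt_eq_rpow]
  norm_num

lemma continuous_hermiteScaled (n : ℕ) (lam : ℤ) : Continuous (hermiteScaled n lam) :=
  continuous_const.mul ((continuous_hermiteFun n).comp (continuous_const.mul continuous_id))

lemma integrable_hermiteScaled_sq (n : ℕ) {lam : ℤ} (h : lam ≠ 0) :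
    Integrable (fun u => hermiteScaled n lam u ^ 2) := by
  simp only [hermiteScaled_sq]
  exact ((integrable_hermiteFun_sq n).comp_mul_left' (heisenbergScale_pos h).ne').const_mul _

lemma integral_hermiteScaled_sq (n : ℕ) {lam : ℤ} (h : lam ≠ 0) :
    ∫ u, hermiteScaled n lam u ^ 2 = 1 := by
  have hs := heisenbergScale_pos h
  simp only [hermiteScaled_sq]
  rw [integral_const_mul,
    Measure.integral_comp_mul_left (fun t => hermiteFun n t ^ 2) (heisenbergScale lam),
    integral_hermiteFun_sq, abs_of_pos (inv_pos.2 hs), smul_eq_mul, mul_one,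
    mul_inv_cancel₀ hs.ne']

lemma tsum_weighted_hermiteScaled_sq_le (n : ℕ) {lam : ℤ} (h : lam ≠ 0) (a : ℝ) :
    Summable (fun k : ℤ =>
      (1 + (heisenbergScale lam / √(2 * n + 1) * ((k : ℝ) / lam + a)) ^ 2) *
        hermiteScaled n lam ((k : ℝ) / lam + a) ^ 2) ∧
    ∑' k : ℤ, (1 + (heisenbergScale lam / √(2 * n + 1) * ((k : ℝ) / lam + a)) ^ 2) *
        hermiteScaled n lam ((k : ℝ) / lam + a) ^ 2 ≤
      2 * |(lam : ℝ)| + 6 * (heisenbergScale lam * √(2 * n + 1)) := by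
  have hs := heisenbergScale_pos h
  have hl : (lam : ℝ) ≠ 0 := by exact_mod_cast h
  obtain ⟨f', h1, h2, h3, h4, h5, h6⟩ := exists_deriv_weighted_hermiteFun_sq n
  obtain ⟨h7, h8⟩ := tsum_abs_lattice_le h1 h2 h3 h4 (div_ne_zero hs.ne' hl)
    (heisenbergScale lam * a)
  set s := heisenbergScale lam with hsdef
  set r := √(2 * (n : ℝ) + 1)
  have e : ∀ k : ℤ, (1 + (s / r * ((k : ℝ) / lam + a)) ^ 2) *
        hermiteScaled n lam ((k : ℝ) / lam + a) ^ 2 =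
      s * |(1 + ((s / lam * k + s * a) / r) ^ 2) * hermiteFun n (s / lam * k + s * a) ^ 2| := by
    intro k
    rw [abs_of_nonneg (by positivity), hermiteScaled_sq, ← hsdef]
    have e1 : s * ((k : ℝ) / lam + a) = s / lam * k + s * a := by ring
    rw [← e1]
    ring
  simp only [e]
  refine ⟨h7.mul_left s, ?_⟩
  rw [tsum_mul_left]
  have e2 : |s / (lam : ℝ)|⁻¹ = |(lam : ℝ)| / s := by
    rw [abs_div, abs_of_pos hs, inv_div]
  rw [e2] at h8
  have h9 : |(lam : ℝ)| / s * (∫ t, |(1 + (t / r) ^ 2) * hermiteFun n t ^ 2|) ≤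
      |(lam : ℝ)| / s * 2 := mul_le_mul_of_nonneg_left h5 (by positivity)
  calc _ ≤ s * (|(lam : ℝ)| / s * 2 + 6 * r) :=
        mul_le_mul_of_nonneg_left (by linarith) hs.le
    _ = _ := by field_simp

/-- Parseval's identity for absolutely convergent Fourier series. -/
lemma integral_norm_sq_fourier_series {A : ℤ → ℂ} (hA : Summable (fun k => ‖A k‖)) :
    ∫ b in Set.Icc (0 : ℝ) 1, ‖∑' k : ℤ, A k * Complex.exp (2 * π * Complex.I * k * b)‖ ^ 2 =
      ∑' k, ‖A k‖ ^ 2 := by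
  have : Fact ((0 : ℝ) < 1) := ⟨one_pos⟩
  have hs : Summable (fun k : ℤ => A k • (fourier k : C(AddCircle (1 : ℝ), ℂ))) := by
    refine Summable.of_norm ?_
    simpa [norm_smul, fourier_norm] using hA
  set g : C(AddCircle (1 : ℝ), ℂ) := ∑' k, A k • fourier k with hg
  have hcoef : ∀ i, fourierCoeff (ContinuousMap.toLp 2 AddCircle.haarAddCircle ℂ g) i = A i := by
    intro i
    have h1 := hs.hasSum.mapL (ContinuousMap.toLp (E := ℂ) 2 (AddCircle.haarAddCircle (T := (1 : ℝ))) ℂ)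
    have h2 := h1.mapL (innerSL ℂ (fourierLp (T := (1 : ℝ)) 2 i))
    have h3 := h2.tsum_eq
    rw [← fourierBasis_repr, HilbertBasis.repr_apply_apply, coe_fourierBasis]
    simp only [innerSL_apply_apply, map_smul] at h3
    rw [← hg] at h3
    rw [← h3, tsum_eq_single i]
    · have := orthonormal_iff_ite.1 (orthonormal_fourier (T := (1 : ℝ))) i i
      rw [if_pos rfl] at this
      erw [this]
      simp
    · intro j hj
      have := orthonormal_iff_ite.1 (orthonormal_fourier (T := (1 : ℝ))) i j
      rw [if_neg hj.symm] at this
      erw [this]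
      simp
  have hP := tsum_sq_fourierCoeff (ContinuousMap.toLp 2 AddCircle.haarAddCircle ℂ g)
  simp only [hcoef] at hP
  rw [hP]
  have h4 : ∫ t, ‖(ContinuousMap.toLp 2 AddCircle.haarAddCircle ℂ g) t‖ ^ 2
      ∂(AddCircle.haarAddCircle (T := (1 : ℝ))) = ∫ t, ‖g t‖ ^ 2 ∂AddCircle.haarAddCircle := by
    refine integral_congr_ae ?_
    filter_upwards [ContinuousMap.coeFn_toLp (p := 2) (𝕜 := ℂ)
      (AddCircle.haarAddCircle (T := (1 : ℝ))) g] with t ht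
    rw [ht]
  rw [h4, AddCircle.integral_haarAddCircle, inv_one, one_smul,
    ← AddCircle.intervalIntegral_preimage (1 : ℝ) 0 (fun t => ‖g t‖ ^ 2), zero_add,
    intervalIntegral.integral_of_le zero_le_one, integral_Icc_eq_integral_Ioc]
  refine integral_congr_ae (Filter.Eventually.of_forall fun b => ?_)
  have h5 := hs.hasSum.mapL (ContinuousMap.evalCLM ℂ (b : AddCircle (1 : ℝ)))
  have h6 := h5.tsum_eq
  simp at h6
  simp only [hg, ← h6]

/-- Plancherel's identity for the discrete Fourier transform. -/
lemma sum_norm_sq_dft {N : ℕ} [NeZero N] (γ : ZMod N → ℂ) :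
    ∑ k, ‖ZMod.dft γ k‖ ^ 2 = N * ∑ q, ‖γ q‖ ^ 2 := by
  have hconj : ∀ x : ZMod N, conj (ZMod.stdAddChar x) = (ZMod.stdAddChar (-x) : ℂ) := by
    intro x
    rw [AddChar.map_neg_eq_conj]
  have key : ∑ k, ZMod.dft γ k * conj (ZMod.dft γ k) = N * ∑ q, γ q * conj (γ q) := by
    have h1 : ∀ k, ZMod.dft γ k * conj (ZMod.dft γ k) =
        ∑ q, conj (γ q) * (ZMod.stdAddChar (q * k) * ZMod.dft γ k) := by
      intro k
      conv_lhs => rw [ZMod.dft_apply γ k]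
      rw [← ZMod.dft_apply γ k, ZMod.dft_apply γ k, map_sum, Finset.mul_sum]
      refine Finset.sum_congr rfl fun q _ => ?_
      rw [smul_eq_mul, map_mul, hconj, neg_neg]
      ring
    simp only [h1]
    rw [Finset.sum_comm, Finset.mul_sum]
    refine Finset.sum_congr rfl fun q _ => ?_
    rw [← Finset.mul_sum]
    have h2 := congrFun (ZMod.dft_dft γ) (-q)
    rw [ZMod.dft_apply] at h2
    simp only [neg_neg, smul_eq_mul, mul_neg] at h2
    have h3 : ∑ k, ZMod.stdAddChar (q * k) * ZMod.dft γ k = N * γ q := by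
      rw [← h2]
      refine Finset.sum_congr rfl fun k _ => ?_
      rw [mul_comm q k]
    rw [h3]
    ring
  simp only [Complex.mul_conj, Complex.normSq_eq_norm_sq] at key
  exact_mod_cast key

/-- The Fourier coefficient sequence `k ↦ ∑_q γ(q) e^{-2πiqk/λ}`, as a function on `ℤ/λℤ`. -/
noncomputable def clusterCoeff {lam : ℤ} [NeZero lam.natAbs] (γ : ZMod lam.natAbs → ℂ)
    (k : ZMod lam.natAbs) : ℂ :=
  ZMod.dft γ ((lam.sign : ZMod lam.natAbs) * k)

lemma sum_norm_sq_clusterCoeff {lam : ℤ} [NeZero lam.natAbs] (γ : ZMod lam.natAbs → ℂ) :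
    ∑ k, ‖clusterCoeff γ k‖ ^ 2 = |(lam : ℝ)| * ∑ q, ‖γ q‖ ^ 2 := by
  have hlam : lam ≠ 0 := Int.natAbs_ne_zero.1 (NeZero.ne lam.natAbs)
  have h1 : |(lam : ℝ)| = lam.natAbs := by rw [Nat.cast_natAbs, Int.cast_abs]
  rw [h1, ← sum_norm_sq_dft]
  simp only [clusterCoeff]
  rcases hlam.lt_or_gt with h | h
  · rw [Int.sign_eq_neg_one_of_neg h]
    simpa using Equiv.sum_comp (Equiv.neg (ZMod lam.natAbs)) fun k => ‖ZMod.dft γ k‖ ^ 2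
  · simp [Int.sign_eq_one_of_pos h]

lemma clusterCoeff_intCast {lam : ℤ} [NeZero lam.natAbs] (γ : ZMod lam.natAbs → ℂ) (k : ℤ) :
    clusterCoeff γ (k : ZMod lam.natAbs) = ∑ q, γ q *
      Complex.exp (-(2 * (π : ℂ) * Complex.I * ((q.val : ℤ) : ℂ) * (k : ℂ)) / (lam : ℂ)) := by
  have hlam : lam ≠ 0 := Int.natAbs_ne_zero.1 (NeZero.ne lam.natAbs)
  rw [clusterCoeff, ZMod.dft_apply]
  refine Finset.sum_congr rfl fun q _ => ?_
  have e : -(q * ((lam.sign : ZMod lam.natAbs) * (k : ZMod lam.natAbs))) =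
      ((-(q.val * (lam.sign * k)) : ℤ) : ZMod lam.natAbs) := by
    push_cast
    rw [ZMod.natCast_zmod_val]
  have hN : (lam.natAbs : ℂ) ≠ 0 := Nat.cast_ne_zero.2 (NeZero.ne lam.natAbs)
  have hs : (lam : ℂ) = lam.sign * lam.natAbs := by
    rw [← Int.cast_natCast, ← Int.cast_mul, Int.sign_mul_natAbs]
  have hss : (lam.sign : ℂ) * lam.sign = 1 := by
    rcases hlam.lt_or_gt with h | h
    · simp [Int.sign_eq_neg_one_of_neg h]
    · simp [Int.sign_eq_one_of_pos h]
  have hs0 : (lam.sign : ℂ) ≠ 0 := left_ne_zero_of_mul (hss.trans_ne one_ne_zero)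
  rw [e, ZMod.stdAddChar_coe, smul_eq_mul, mul_comm, hs]
  congr 2
  push_cast
  field_simp
  linear_combination (-(q.val * k : ℂ)) * hss

lemma tsum_periodic_mul_abs_hermiteScaled_sq_le {lam : ℤ} [NeZero lam.natAbs] (n : ℕ)
    (v : ZMod lam.natAbs → ℝ) (hv : ∀ r, 0 ≤ v r) (a : ℝ) :
    Summable (fun k : ℤ => v (k : ZMod lam.natAbs) * |hermiteScaled n lam ((k : ℝ) / lam + a)|) ∧
      (∑' k : ℤ, v (k : ZMod lam.natAbs) * |hermiteScaled n lam ((k : ℝ) / lam + a)|) ^ 2 ≤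
        56 * (heisenbergScale lam ^ 2 * (2 * n + 1)) * ∑ r, v r ^ 2 := by
  have hlam : lam ≠ 0 := Int.natAbs_ne_zero.1 (NeZero.ne lam.natAbs)
  have hs := heisenbergScale_pos hlam
  have hL : (0 : ℝ) < 2 * n + 1 := by positivity
  obtain ⟨h1, h2⟩ := tsum_weighted_hermiteScaled_sq_le n hlam a
  have hr : 1 ≤ √(2 * (n : ℝ) + 1) := Real.one_le_sqrt.2 (by linarith [n.cast_nonneg (α := ℝ)])
  have hr2 : √(2 * (n : ℝ) + 1) ^ 2 = 2 * n + 1 := Real.sq_sqrt hL.le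
  have hs2 := heisenbergScale_sq lam
  have hN : (1 : ℝ) ≤ |(lam : ℝ)| := by exact_mod_cast Int.one_le_abs hlam
  set s := heisenbergScale lam with hsdef
  set r := √(2 * (n : ℝ) + 1) with hrdef
  have hs1 : 1 ≤ s := by nlinarith [Real.pi_gt_three]
  obtain ⟨h3, h4⟩ := tsum_periodic_mul_le (fun i => v i ^ 2) (fun i => sq_nonneg _)
    (f := fun x => (1 + (s / r * x) ^ 2)⁻¹) (fun x => by positivity)
    (fun x => tsum_inv_one_add_sq_le (by positivity : 0 < s / r) x) a
  have hW : ∀ x : ℝ, 0 < 1 + x ^ 2 := fun x => by positivity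
  have e1 : ∀ k : ℤ, (v (k : ZMod lam.natAbs) * (√(1 + (s / r * ((k : ℝ) / lam + a)) ^ 2))⁻¹) ^ 2 =
      v (k : ZMod lam.natAbs) ^ 2 * (1 + (s / r * ((k : ℝ) / lam + a)) ^ 2)⁻¹ := fun k => by
    rw [mul_pow, inv_pow, Real.sq_sqrt (hW _).le]
  have e2 : ∀ k : ℤ, (√(1 + (s / r * ((k : ℝ) / lam + a)) ^ 2) *
        |hermiteScaled n lam ((k : ℝ) / lam + a)|) ^ 2 =
      (1 + (s / r * ((k : ℝ) / lam + a)) ^ 2) * hermiteScaled n lam ((k : ℝ) / lam + a) ^ 2 :=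
    fun k => by rw [mul_pow, sq_abs, Real.sq_sqrt (hW _).le]
  have e3 : ∀ k : ℤ, v (k : ZMod lam.natAbs) * (√(1 + (s / r * ((k : ℝ) / lam + a)) ^ 2))⁻¹ *
        (√(1 + (s / r * ((k : ℝ) / lam + a)) ^ 2) *
          |hermiteScaled n lam ((k : ℝ) / lam + a)|) =
      v (k : ZMod lam.natAbs) * |hermiteScaled n lam ((k : ℝ) / lam + a)| := fun k => by
    have := (Real.sqrt_pos.2 (hW (s / r * ((k : ℝ) / lam + a)))).ne'
    field_simp
  obtain ⟨h5, h6⟩ := tsum_mul_sq_le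
    (f := fun k : ℤ => v (k : ZMod lam.natAbs) * (√(1 + (s / r * ((k : ℝ) / lam + a)) ^ 2))⁻¹)
    (g := fun k : ℤ => √(1 + (s / r * ((k : ℝ) / lam + a)) ^ 2) *
      |hermiteScaled n lam ((k : ℝ) / lam + a)|)
    (fun k => mul_nonneg (hv _) (by positivity)) (fun k => by positivity)
    (by simpa only [e1] using h3) (by simpa only [e2] using h1)
  simp only [e1, e2, e3] at h5 h6
  refine ⟨h5, h6.trans ?_⟩
  have hV : 0 ≤ ∑ i, v i ^ 2 := Finset.sum_nonneg fun i _ => sq_nonneg _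
  have hB : 0 ≤ 2 * |(lam : ℝ)| + 6 * (s * r) := by positivity
  refine (mul_le_mul h4 h2 (tsum_nonneg fun k => by positivity)
    (by have := Real.pi_pos; positivity)).trans ?_
  have key : π * ((s / r)⁻¹ + 1) * (2 * |(lam : ℝ)| + 6 * (s * r)) ≤
      56 * (s ^ 2 * r ^ 2) := by
    have hπ := Real.pi_pos
    have hl : |(lam : ℝ)| = s ^ 2 / (2 * π) := by rw [hs2]; field_simp
    have e4 : π * ((s / r)⁻¹ + 1) * (2 * |(lam : ℝ)| + 6 * (s * r)) =
        s * r + 6 * π * r ^ 2 + s ^ 2 + 6 * π * (s * r) := by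
      rw [hl]; field_simp; ring
    have hr0 : 0 < r := by linarith
    have p1 : 1 ≤ s * r := one_le_mul_of_one_le_of_one_le hs1 hr
    have p2 : s * r ≤ s ^ 2 * r ^ 2 := by nlinarith
    have p3 : r ^ 2 ≤ s ^ 2 * r ^ 2 := le_mul_of_one_le_left (sq_nonneg r) (by nlinarith)
    have p4 : s ^ 2 ≤ s ^ 2 * r ^ 2 := le_mul_of_one_le_right (sq_nonneg s) (by nlinarith)
    have p5 : 6 * π * r ^ 2 ≤ 6 * π * (s ^ 2 * r ^ 2) :=
      mul_le_mul_of_nonneg_left p3 (by positivity)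
    have p6 : 6 * π * (s * r) ≤ 6 * π * (s ^ 2 * r ^ 2) :=
      mul_le_mul_of_nonneg_left p2 (by positivity)
    have p7 : 12 * π * (s ^ 2 * r ^ 2) ≤ 12 * 4 * (s ^ 2 * r ^ 2) :=
      mul_le_mul_of_nonneg_right (by linarith [Real.pi_lt_four]) (by positivity)
    have p8 : 0 ≤ s ^ 2 * r ^ 2 := by positivity
    rw [e4]
    linarith
  rw [hr2] at key
  calc _ = π * ((s / r)⁻¹ + 1) * (2 * |(lam : ℝ)| + 6 * (s * r)) * ∑ i, v i ^ 2 := by ring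
    _ ≤ _ := mul_le_mul_of_nonneg_right key hV

/-- The periodic Fourier series whose modulus is `√|λ|` times that of the spectral cluster. -/
noncomputable def clusterSeries {lam : ℤ} [NeZero lam.natAbs] (γ : ZMod lam.natAbs → ℂ) (n : ℕ)
    (a b : ℝ) : ℂ :=
  ∑' k : ℤ, clusterCoeff γ (k : ZMod lam.natAbs) * (hermiteScaled n lam ((k : ℝ) / lam + a) : ℂ) *
    Complex.exp (2 * π * Complex.I * k * b)

lemma norm_exp_two_pi_I_mul_real (k : ℤ) (b : ℝ) :
    ‖Complex.exp (2 * π * Complex.I * k * b)‖ = 1 := by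
  have : 2 * (π : ℂ) * Complex.I * k * b = ((2 * π * k * b : ℝ) : ℂ) * Complex.I := by
    push_cast; ring
  rw [this, Complex.norm_exp_ofReal_mul_I]

lemma summable_norm_clusterCoeff_mul {lam : ℤ} [NeZero lam.natAbs] (γ : ZMod lam.natAbs → ℂ)
    (n : ℕ) (a : ℝ) :
    Summable (fun k : ℤ => ‖clusterCoeff γ (k : ZMod lam.natAbs) *
      (hermiteScaled n lam ((k : ℝ) / lam + a) : ℂ)‖) := by
  simpa using (tsum_periodic_mul_abs_hermiteScaled_sq_le n (fun i => ‖clusterCoeff γ i‖)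
    (fun _ => norm_nonneg _) a).1

lemma norm_clusterSeries_sq_le {lam : ℤ} [NeZero lam.natAbs] (γ : ZMod lam.natAbs → ℂ) (n : ℕ)
    (a b : ℝ) :
    ‖clusterSeries γ n a b‖ ^ 2 ≤
      56 * (heisenbergScale lam ^ 2 * (2 * n + 1)) * (|(lam : ℝ)| * ∑ q, ‖γ q‖ ^ 2) := by
  obtain ⟨h1, h2⟩ := tsum_periodic_mul_abs_hermiteScaled_sq_le (lam := lam) n
    (fun i => ‖clusterCoeff γ i‖) (fun _ => norm_nonneg _) a
  rw [sum_norm_sq_clusterCoeff] at h2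
  refine (pow_le_pow_left₀ (norm_nonneg _) ?_ 2).trans h2
  refine tsum_of_norm_bounded h1.hasSum fun k => ?_
  rw [norm_mul, norm_mul, norm_exp_two_pi_I_mul_real, mul_one, Complex.norm_real, Real.norm_eq_abs]

lemma continuous_clusterSeries {lam : ℤ} [NeZero lam.natAbs] (γ : ZMod lam.natAbs → ℂ) (n : ℕ)
    (a : ℝ) : Continuous (clusterSeries γ n a) := by
  refine continuous_tsum (fun k => by fun_prop) (summable_norm_clusterCoeff_mul γ n a) fun k b => ?_
  rw [norm_mul, norm_exp_two_pi_I_mul_real, mul_one]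

lemma integral_norm_clusterSeries_sq {lam : ℤ} [NeZero lam.natAbs] (γ : ZMod lam.natAbs → ℂ)
    (n : ℕ) (a : ℝ) :
    ∫ b in Set.Icc (0 : ℝ) 1, ‖clusterSeries γ n a b‖ ^ 2 =
      ∑' k : ℤ, ‖clusterCoeff γ (k : ZMod lam.natAbs)‖ ^ 2 *
        hermiteScaled n lam ((k : ℝ) / lam + a) ^ 2 := by
  refine (integral_norm_sq_fourier_series (summable_norm_clusterCoeff_mul γ n a)).trans ?_
  simp [mul_pow]

lemma integral_periodic_mul_hermiteScaled_sq_le {lam : ℤ} [NeZero lam.natAbs] (n : ℕ)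
    (w : ZMod lam.natAbs → ℝ) (hw : ∀ r, 0 ≤ w r) :
    IntegrableOn (fun a => ∑' k : ℤ, w (k : ZMod lam.natAbs) *
        hermiteScaled n lam ((k : ℝ) / lam + a) ^ 2) (Set.Icc (0 : ℝ) 1) ∧
      ∫ a in Set.Icc (0 : ℝ) 1, ∑' k : ℤ, w (k : ZMod lam.natAbs) *
        hermiteScaled n lam ((k : ℝ) / lam + a) ^ 2 ≤ ∑ r, w r := by
  have hlam : lam ≠ 0 := Int.natAbs_ne_zero.1 (NeZero.ne lam.natAbs)
  have hc := continuous_hermiteScaled n lam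
  have hW : 0 ≤ ∑ r, w r := Finset.sum_nonneg fun i _ => hw i
  have hterm : ∀ a : ℝ, ∀ k : ℤ, w (k : ZMod lam.natAbs) *
      hermiteScaled n lam ((k : ℝ) / lam + a) ^ 2 ≤ (∑ r, w r) *
        ((1 + (heisenbergScale lam / √(2 * n + 1) * ((k : ℝ) / lam + a)) ^ 2) *
          hermiteScaled n lam ((k : ℝ) / lam + a) ^ 2) := fun a k =>
    mul_le_mul (Finset.single_le_sum (fun i _ => hw i) (Finset.mem_univ _))
      (le_mul_of_one_le_left (sq_nonneg _) (le_add_of_nonneg_right (sq_nonneg _)))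
      (sq_nonneg _) hW
  have hsum : ∀ a : ℝ, Summable (fun k : ℤ => w (k : ZMod lam.natAbs) *
      hermiteScaled n lam ((k : ℝ) / lam + a) ^ 2) := fun a =>
    Summable.of_nonneg_of_le (fun k => mul_nonneg (hw _) (sq_nonneg _)) (hterm a)
      ((tsum_weighted_hermiteScaled_sq_le n hlam a).1.mul_left _)
  constructor
  · refine Measure.integrableOn_of_bounded (M := (∑ r, w r) *
      (2 * |(lam : ℝ)| + 6 * (heisenbergScale lam * √(2 * n + 1)))) (by simp) ?_ ?_
    · refine aestronglyMeasurable_of_tendsto_ae (Filter.atTop : Filter (Finset ℤ))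
        (f := fun u a => ∑ k ∈ u, w (k : ZMod lam.natAbs) *
          hermiteScaled n lam ((k : ℝ) / lam + a) ^ 2)
        (fun u => Continuous.aestronglyMeasurable (by fun_prop))
        (Filter.Eventually.of_forall fun a => (hsum a).hasSum)
    · refine Filter.Eventually.of_forall fun a => ?_
      obtain ⟨h1, h2⟩ := tsum_weighted_hermiteScaled_sq_le n hlam a
      rw [Real.norm_of_nonneg (tsum_nonneg fun k => mul_nonneg (hw _) (sq_nonneg _))]
      refine ((hsum a).tsum_le_tsum (hterm a) (h1.mul_left _)).trans ?_
      rw [tsum_mul_left]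
      exact mul_le_mul_of_nonneg_left h2 hW
  · have hint : ∀ x : ℝ, IntegrableOn (fun a => hermiteScaled n lam (x + a) ^ 2)
        (Set.Icc (0 : ℝ) 1) := fun x =>
      (Continuous.continuousOn (by fun_prop)).integrableOn_compact isCompact_Icc
    have hf : ∀ x : ℝ, HasSum
        (fun j : ℤ => ∫ a in Set.Icc (0 : ℝ) 1, hermiteScaled n lam (x + j + a) ^ 2) 1 := by
      intro x
      have h := ((integrable_hermiteScaled_sq n hlam).comp_add_left
        x).hasSum_intervalIntegral_comp_add_int
      rw [integral_add_left_eq_self (fun u => hermiteScaled n lam u ^ 2),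
        integral_hermiteScaled_sq n hlam] at h
      simpa only [intervalIntegral.integral_of_le zero_le_one, ← integral_Icc_eq_integral_Ioc,
        add_assoc, add_comm, add_left_comm] using h
    obtain ⟨h1, h2⟩ := tsum_periodic_mul_le w hw
      (f := fun x => ∫ a in Set.Icc (0 : ℝ) 1, hermiteScaled n lam (x + a) ^ 2)
      (fun x => integral_nonneg fun a => sq_nonneg _)
      (fun x => ⟨(hf x).summable, (hf x).tsum_eq.le⟩) 0
    simp only [add_zero, one_mul] at h1 h2
    rw [← integral_tsum_of_summable_integral_norm (fun k => (hint _).const_mul _)]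
    · simpa only [integral_const_mul] using h2
    · refine h1.congr fun k => ?_
      rw [← integral_const_mul]
      refine integral_congr_ae (Filter.Eventually.of_forall fun a => ?_)
      exact (Real.norm_of_nonneg (mul_nonneg (hw _) (sq_nonneg _))).symm

lemma norm_cluster_eq {lam : ℤ} [NeZero lam.natAbs] (γ : ZMod lam.natAbs → ℂ) (n : ℕ)
    (a b c : ℝ) :
    ‖∑' q : ZMod lam.natAbs, γ q * hBWZ lam (q.val : ℤ) n (a, b, c)‖ ^ 4 =
      (|(lam : ℝ)| ^ 2)⁻¹ * ‖clusterSeries γ n a b‖ ^ 4 := by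
  have hlam : lam ≠ 0 := Int.natAbs_ne_zero.1 (NeZero.ne lam.natAbs)
  have hl : 0 < |(lam : ℝ)| := abs_pos.2 (by exact_mod_cast hlam)
  have hs : Summable (fun k : ℤ => |hermiteScaled n lam ((k : ℝ) / lam + a)|) := by
    simpa using (tsum_periodic_mul_abs_hermiteScaled_sq_le n (fun _ : ZMod lam.natAbs => 1)
      (fun _ => zero_le_one) a).1
  set P : ℂ := ((√|(lam : ℝ)| / (lam : ℝ) : ℝ) : ℂ) with hPdef
  set E : ℂ := Complex.exp (((2 * π * (lam * c) : ℝ) : ℂ) * Complex.I) with hE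
  have key : ∑' q : ZMod lam.natAbs, γ q * hBWZ lam (q.val : ℤ) n (a, b, c) =
      P * E * clusterSeries γ n a b := by
    rw [tsum_fintype, clusterSeries]
    simp only [hBWZ, BWZ, clusterCoeff_intCast, Finset.sum_mul]
    have hsq : ∀ q : ZMod lam.natAbs, Summable (fun k : ℤ => γ q * Complex.exp
        (-(2 * (π : ℂ) * Complex.I * ((q.val : ℤ) : ℂ) * (k : ℂ)) / (lam : ℂ)) *
        (hermiteScaled n lam ((k : ℝ) / lam + a) : ℂ) *
        Complex.exp (2 * π * Complex.I * k * b)) := by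
      intro q
      refine Summable.of_norm_bounded (hs.mul_left ‖γ q‖) fun k => ?_
      have e : -(2 * (π : ℂ) * Complex.I * ((q.val : ℤ) : ℂ) * (k : ℂ)) / (lam : ℂ) =
          ((-(2 * π * q.val * k) / lam : ℝ) : ℂ) * Complex.I := by
        push_cast; ring
      rw [norm_mul, norm_mul, norm_mul, norm_exp_two_pi_I_mul_real, e,
        Complex.norm_exp_ofReal_mul_I, mul_one, mul_one, Complex.norm_real, Real.norm_eq_abs]
    rw [Summable.tsum_finsetSum fun q _ => hsq q, Finset.mul_sum]
    refine Finset.sum_congr rfl fun q _ => ?_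
    rw [← tsum_mul_left, ← tsum_mul_left, ← tsum_mul_left]
    refine tsum_congr fun k => ?_
    have e : Complex.exp (2 * (π : ℂ) * Complex.I * ((lam : ℂ) * (c : ℂ) + (k : ℂ) * (b : ℂ))) =
        E * Complex.exp (2 * π * Complex.I * k * b) := by
      rw [← Complex.exp_add]
      congr 1
      push_cast; ring
    rw [e]
    ring
  have hP : ‖P‖ ^ 4 = (|(lam : ℝ)| ^ 2)⁻¹ := by
    have h4 : √|(lam : ℝ)| ^ 4 = |(lam : ℝ)| ^ 2 := by
      rw [show 4 = 2 * 2 from rfl, pow_mul, Real.sq_sqrt hl.le]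
    rw [Complex.norm_real, norm_div, Real.norm_of_nonneg (Real.sqrt_nonneg _), Real.norm_eq_abs,
      div_pow, h4]
    field_simp
  rw [key, norm_mul, norm_mul, hE, Complex.norm_exp_ofReal_mul_I, mul_one, mul_pow, hP]

/-- The fourth power of the `L⁴` norm of a spectral cluster is `O(μ² ‖γ‖⁴)`. -/
lemma integral_norm_cluster_pow_four_le {lam : ℤ} [NeZero lam.natAbs] (γ : ZMod lam.natAbs → ℂ)
    (n : ℕ) :
    ∫ a in Set.Icc (0:ℝ) 1, ∫ b in Set.Icc (0:ℝ) 1, ∫ c in Set.Icc (0:ℝ) 1,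
        ‖∑' q : ZMod lam.natAbs, γ q * hBWZ lam (q.val : ℤ) n (a, b, c)‖ ^ 4 ≤
      56 * (2 * π * |(lam : ℝ)| * (2 * n + 1)) * (∑ q, ‖γ q‖ ^ 2) ^ 2 := by
  have hlam : lam ≠ 0 := Int.natAbs_ne_zero.1 (NeZero.ne lam.natAbs)
  have hl : 0 < |(lam : ℝ)| := abs_pos.2 (by exact_mod_cast hlam)
  obtain ⟨h1, h2⟩ := integral_periodic_mul_hermiteScaled_sq_le n
    (fun i : ZMod lam.natAbs => ‖clusterCoeff γ i‖ ^ 2) (fun _ => sq_nonneg _)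
  rw [sum_norm_sq_clusterCoeff] at h2
  simp only [← integral_norm_clusterSeries_sq] at h1 h2
  simp only [norm_cluster_eq, integral_const, integral_const_mul, smul_eq_mul]
  have hv : volume.real (Set.Icc (0 : ℝ) 1) = 1 := by simp
  simp only [measureReal_restrict_apply_univ, hv, one_mul]
  set M : ℝ := 56 * (heisenbergScale lam ^ 2 * (2 * n + 1)) * (|(lam : ℝ)| * ∑ q, ‖γ q‖ ^ 2)
    with hM
  have hM0 : 0 ≤ M := by positivity
  have hb : ∀ a, ∫ b in Set.Icc (0 : ℝ) 1, ‖clusterSeries γ n a b‖ ^ 4 ≤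
      M * ∫ b in Set.Icc (0 : ℝ) 1, ‖clusterSeries γ n a b‖ ^ 2 := by
    intro a
    have hc := continuous_clusterSeries γ n a
    rw [← integral_const_mul]
    refine integral_mono_of_nonneg (Filter.Eventually.of_forall fun b => by positivity)
      ((Continuous.continuousOn (by fun_prop)).integrableOn_compact isCompact_Icc)
      (Filter.Eventually.of_forall fun b => ?_)
    have e : ‖clusterSeries γ n a b‖ ^ 4 =
      ‖clusterSeries γ n a b‖ ^ 2 * ‖clusterSeries γ n a b‖ ^ 2 := by ring
    simp only [e]
    exact mul_le_mul_of_nonneg_right (norm_clusterSeries_sq_le γ n a b) (sq_nonneg _)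
  have ha : ∫ a in Set.Icc (0 : ℝ) 1, ∫ b in Set.Icc (0 : ℝ) 1, ‖clusterSeries γ n a b‖ ^ 4 ≤
      M * (|(lam : ℝ)| * ∑ q, ‖γ q‖ ^ 2) := by
    refine le_trans ?_ (mul_le_mul_of_nonneg_left h2 hM0)
    rw [← integral_const_mul]
    exact integral_mono_of_nonneg
      (Filter.Eventually.of_forall fun a => integral_nonneg fun b => by positivity)
      (h1.const_mul M) (Filter.Eventually.of_forall hb)
  refine (mul_le_mul_of_nonneg_left ha (by positivity)).trans_eq ?_
  rw [hM, heisenbergScale_sq]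
  field_simp

/-- **L⁴ bound for spectral clusters from a single `λ`**: with `μ = √(2π|λ|(2ℓ+1))`,
`‖∑_q γ(q) h_{λ,q,ℓ}‖_{L⁴([0,1]³)} ≤ C_ε μ^{(1+ε)/2} ‖γ‖_{ℓ²}`. -/
theorem single_lambda_cluster_L4_bound (ε : ℝ) (hε : 0 < ε) (hε1 : ε < 1) :
    ∃ C > (0 : ℝ), ∀ (lam : ℤ), lam ≠ 0 → ∀ (ℓ : ℕ) (γ : ZMod lam.natAbs → ℂ),
      (∫ a in Set.Icc (0:ℝ) 1, ∫ b in Set.Icc (0:ℝ) 1, ∫ c in Set.Icc (0:ℝ) 1,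
          ‖∑' q : ZMod lam.natAbs, γ q * hBWZ lam (q.val : ℤ) ℓ (a, b, c)‖ ^ 4) ^ ((1 : ℝ) / 4)
        ≤ C * (Real.sqrt (2 * π * |(lam : ℝ)| * (2 * (ℓ : ℝ) + 1))) ^ ((1 + ε) / 2) *
            (∑' q : ZMod lam.natAbs, ‖γ q‖ ^ 2) ^ ((1 : ℝ) / 2) := by
  refine ⟨56, by norm_num, fun lam hlam n γ => ?_⟩
  have : NeZero lam.natAbs := ⟨Int.natAbs_ne_zero.2 hlam⟩
  rw [tsum_fintype]
  have hN : (1 : ℝ) ≤ |(lam : ℝ)| := by exact_mod_cast Int.one_le_abs hlam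
  have hX : 1 ≤ 2 * π * |(lam : ℝ)| * (2 * (n : ℝ) + 1) :=
    one_le_mul_of_one_le_of_one_le
      (one_le_mul_of_one_le_of_one_le (by linarith [Real.pi_gt_three]) hN)
      (by linarith [n.cast_nonneg (α := ℝ)])
  have hI := integral_norm_cluster_pow_four_le γ n
  set X : ℝ := 2 * π * |(lam : ℝ)| * (2 * (n : ℝ) + 1)
  set G : ℝ := ∑ q, ‖γ q‖ ^ 2
  have hG : 0 ≤ G := Finset.sum_nonneg fun q _ => sq_nonneg _
  have hX0 : 0 ≤ X := zero_le_one.trans hX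
  calc _ ≤ (56 * X * G ^ 2) ^ ((1 : ℝ) / 4) :=
        Real.rpow_le_rpow (integral_nonneg fun a => integral_nonneg fun b =>
          integral_nonneg fun c => by positivity) hI (by norm_num)
    _ = 56 ^ ((1 : ℝ) / 4) * √X ^ ((1 : ℝ) / 2) * G ^ ((1 : ℝ) / 2) := by
        rw [Real.mul_rpow (by positivity) (by positivity), Real.mul_rpow (by norm_num) hX0,
          Real.sqrt_eq_rpow, ← Real.rpow_mul hX0, ← Real.rpow_natCast, ← Real.rpow_mul hG]
        norm_num
    _ ≤ 56 * √X ^ ((1 + ε) / 2) * G ^ ((1 : ℝ) / 2) := by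
        gcongr
        · exact Real.rpow_le_self_of_one_le (by norm_num) (by norm_num)
        · exact Real.one_le_sqrt.2 hX
        · linarith
end

section
/- (Sharpness of the restriction estimate.) There exist constants C > 0 and λ₀ ∈ ℕ such that for every integer λ ≥ λ₀ there exists a nonzero family γ : ℤ/λℤ → ℂ with ∫_{[0,1]³} |∑_{q∈ℤ/λℤ} γ(q) h_{λ,q,0}(a,b,c)|⁴ da db dc ≥ C · λ · (∑_{q∈ℤ/λℤ} |γ(q)|²)². Equivalently, setting μ = √(2πλ), the ratio of the L⁴([0,1]³) norm to the L²([0,1]³) norm of ∑_q γ(q) h_{λ,q,0} is at least C′ μ^{1/2} for some absolute C′ > 0. -/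
open MeasureTheory Real Complex
open scoped ComplexConjugate

/-- If `Im τ` is large compared to `1` and to `|Im z|`, the theta function is close to `1`. -/
lemma norm_jacobiTheta₂_sub_one_le {z τ : ℂ} (hτ : 1 ≤ τ.im) (hz : |z.im| ≤ τ.im / 4) :
    ‖jacobiTheta₂ z τ - 1‖ ≤
      2 * rexp (-(π * τ.im / 2)) / (1 - rexp (-(π * τ.im / 2))) := by
  have hτ0 : 0 < τ.im := by linarith
  set r := rexp (-(π * τ.im / 2)) with hr
  have hr1 : r < 1 := by
    rw [hr, Real.exp_lt_one_iff]
    have := mul_pos pi_pos hτ0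
    linarith
  have hterm : ∀ (m : ℤ) (n : ℕ), m ^ 2 = ((n : ℤ) + 1) ^ 2 →
      ‖jacobiTheta₂_term m z τ‖ ≤ r ^ (n + 1) := by
    intro m n hm
    have hmR : (m : ℝ) ^ 2 = ((n : ℝ) + 1) ^ 2 := by exact_mod_cast hm
    rw [norm_jacobiTheta₂_term, hr, ← Real.exp_nat_mul, Real.exp_le_exp]
    have hn : (0 : ℝ) ≤ n := n.cast_nonneg
    have habs : |(m : ℝ)| = n + 1 := by
      rw [← sq_eq_sq₀ (abs_nonneg _) (by positivity), sq_abs, hmR]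
    have h1 : -((m : ℝ) * z.im) ≤ (n + 1) * (τ.im / 4) := by
      calc -((m : ℝ) * z.im) ≤ |(m : ℝ) * z.im| := neg_le_abs _
        _ = (n + 1) * |z.im| := by rw [abs_mul, habs]
        _ ≤ _ := by gcongr
    have h2 : ((n : ℝ) + 1) * τ.im ≤ ((n : ℝ) + 1) ^ 2 * τ.im := by
      gcongr
      nlinarith
    have h3 : -(m ^ 2 * τ.im) - 2 * (m * z.im) ≤ -((n + 1) * (τ.im / 2)) := by
      rw [hmR]; linarith
    have h4 := mul_le_mul_of_nonneg_left h3 pi_pos.le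
    push_cast
    linarith
  have hsum := (hasSum_jacobiTheta₂_term z hτ0).nat_add_neg
  rw [← hasSum_nat_add_iff' 1] at hsum
  have h0 : jacobiTheta₂_term 0 z τ = 1 := by simp [jacobiTheta₂_term]
  simp only [Finset.sum_range_one, Nat.cast_zero, neg_zero, h0, add_sub_add_right_eq_sub] at hsum
  have hgeo : HasSum (fun n : ℕ ↦ 2 * r ^ (n + 1)) (2 * r / (1 - r)) := by
    have := (hasSum_geometric_of_lt_one (Real.exp_pos _).le hr1).mul_left (2 * r)
    rw [div_eq_mul_inv]
    simpa only [pow_succ', mul_assoc] using! this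
  rw [← hsum.tsum_eq]
  refine tsum_of_norm_bounded hgeo fun n ↦ (norm_add_le _ _).trans ?_
  rw [two_mul]
  exact add_le_add (hterm _ n (by push_cast; ring)) (hterm _ n (by push_cast; ring))

lemma hermiteScaled_zero (lam : ℤ) (u : ℝ) :
    hermiteScaled 0 lam u =
      (2 * π * |(lam : ℝ)|) ^ ((1 : ℝ) / 4) * (√π) ^ (-(1 : ℝ) / 2) *
        rexp (-(π * |(lam : ℝ)| * u ^ 2)) := by
  have hs : √(2 * π * |(lam : ℝ)|) ^ 2 = 2 * π * |(lam : ℝ)| := Real.sq_sqrt (by positivity)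
  have hp : ∀ v : ℝ, hermitePoly 0 v = 1 := fun v ↦ by
    simp [hermitePoly, ← Real.exp_add]
  simp only [hermiteScaled, hermiteFun, hp, pow_zero, Nat.factorial_zero, Nat.cast_one, mul_one,
    mul_pow, hs]
  rw [mul_assoc _ (√π ^ _) _]
  congr 3
  ring

/-- The normalising constant of the rescaled Gaussian. -/
lemma gaussian_const_pow_four {L : ℝ} (hL : 0 ≤ L) :
    ((2 * π * L) ^ ((1 : ℝ) / 4) * (√π) ^ (-(1 : ℝ) / 2)) ^ 4 = 2 * L := by
  have h1 : ((2 * π * L) ^ ((1 : ℝ) / 4)) ^ 4 = 2 * π * L := by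
    rw [← Real.rpow_natCast, ← Real.rpow_mul (by positivity)]
    norm_num
  have h2 : ((√π) ^ (-(1 : ℝ) / 2)) ^ 4 = π⁻¹ := by
    rw [← Real.rpow_natCast, ← Real.rpow_mul (by positivity)]
    norm_num
    exact Real.sq_sqrt pi_pos.le
  rw [mul_pow, h1, h2]
  field_simp

/-- The ground state eigenfunctions in terms of the Jacobi theta function. -/
lemma hBWZ_zero_eq_jacobiTheta₂ (lam : ℕ) (hlam : 0 < lam) (q : ℤ) (a b c : ℝ) :
    hBWZ lam q 0 (a, b, c) =
      ((√(lam : ℝ) / lam *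
        ((2 * π * lam) ^ ((1 : ℝ) / 4) * (√π) ^ (-(1 : ℝ) / 2)) : ℝ) : ℂ) *
      cexp (2 * π * I * (lam * c)) * cexp (-(π * lam * a ^ 2)) *
      jacobiTheta₂ ((b - q / lam : ℝ) + I * a) (I / lam) := by
  have hne : (lam : ℂ) ≠ 0 := by exact_mod_cast hlam.ne'
  have habs : |(((lam : ℤ) : ℝ))| = lam := by simp
  simp only [hBWZ, BWZ, hermiteScaled_zero, habs, jacobiTheta₂]
  set K : ℝ := (2 * π * lam) ^ ((1 : ℝ) / 4) * (√π) ^ (-(1 : ℝ) / 2)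
  rw [← tsum_mul_left, ← tsum_mul_left]
  congr 1
  ext k
  simp only [jacobiTheta₂_term]
  push_cast
  have key : cexp (-(2 * π * I * q * k) / lam) * cexp (2 * π * I * (lam * c + k * b)) *
      cexp (-(π * lam * (k / lam + a) ^ 2)) =
      cexp (2 * π * I * (lam * c)) * cexp (-(π * lam * a ^ 2)) *
        cexp (2 * π * I * k * (b - q / lam + I * a) + π * I * k ^ 2 * (I / lam)) := by
    simp only [← Complex.exp_add]
    congr 1
    field_simp
    linear_combination (-(2 * lam * k * a) - (k : ℂ) ^ 2) * I_sq
  linear_combination (√(lam : ℝ) / lam * K : ℂ) * key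

/-- Poisson summation: near the diagonal, the ground states are wave packets centred at
`(0, q / λ)`. -/
lemma hBWZ_zero_eq_wave_packet (lam : ℕ) (hlam : 0 < lam) (q : ℤ) (a b c : ℝ) :
    hBWZ lam q 0 (a, b, c) =
      (((2 * π * lam) ^ ((1 : ℝ) / 4) * (√π) ^ (-(1 : ℝ) / 2) : ℝ) : ℂ) *
      cexp (2 * π * I * (lam * c)) *
      (cexp (-(π * lam * (b - q / lam : ℝ) ^ 2) - 2 * π * I * lam * (b - q / lam : ℝ) * a) *
      jacobiTheta₂ (lam * a - I * (lam * (b - q / lam : ℝ))) (I * lam)) := by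
  have hne : (lam : ℂ) ≠ 0 := by exact_mod_cast hlam.ne'
  have hneR : (lam : ℝ) ≠ 0 := by exact_mod_cast hlam.ne'
  rw [hBWZ_zero_eq_jacobiTheta₂ lam hlam, jacobiTheta₂_functional_equation]
  set θ : ℝ := b - q / lam
  set K : ℝ := (2 * π * lam) ^ ((1 : ℝ) / 4) * (√π) ^ (-(1 : ℝ) / 2)
  have e1 : ((θ : ℂ) + I * a) / (I / lam) = lam * a - I * (lam * θ) := by
    field_simp
    linear_combination (θ : ℂ) * I_sq
  have e2 : -1 / (I / lam) = I * lam := by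
    field_simp
    linear_combination -I_sq
  have e3 : 1 / (-I * (I / lam)) ^ (1 / 2 : ℂ) = ((√(lam : ℝ) : ℝ) : ℂ) := by
    have : -I * (I / lam) = (((lam : ℝ)⁻¹ : ℝ) : ℂ) := by
      push_cast
      field_simp
      linear_combination -I_sq
    rw [this, show (1 / 2 : ℂ) = ((1 / 2 : ℝ) : ℂ) by push_cast; rfl,
      ← Complex.ofReal_cpow (by positivity), ← Real.sqrt_eq_rpow, Real.sqrt_inv]
    simp
  have e4 : cexp (-(π * lam * a ^ 2)) * cexp (-π * I * (θ + I * a) ^ 2 / (I / lam)) =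
      cexp (-(π * lam * θ ^ 2) - 2 * π * I * lam * θ * a) := by
    rw [← Complex.exp_add]
    congr 1
    field_simp
    linear_combination (-(a : ℂ) ^ 2) * I_sq
  have e5 : ((√(lam : ℝ) / lam * K : ℝ) : ℂ) * ((√(lam : ℝ) : ℝ) : ℂ) = (K : ℂ) := by
    rw [← Complex.ofReal_mul]
    congr 1
    have := Real.mul_self_sqrt (Nat.cast_nonneg (α := ℝ) lam)
    field_simp
    linear_combination K * this
  rw [e1, e2, e3, ← e4, ← e5]
  ring

/-- On a box of side `~ λ^{-1/2}` the wave packets are in phase. -/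
lemma re_wave_packet_ge {L θ a : ℝ} (hL : 64 ≤ L) (hθ : |θ| ≤ 1 / (8 * √L))
    (ha : |a| ≤ 1 / (8 * √L)) :
    1 / 2 ≤ (cexp (-(π * L * θ ^ 2) - 2 * π * I * L * θ * a) *
      jacobiTheta₂ (L * a - I * (L * θ)) (I * L)).re := by
  have hs : √L ^ 2 = L := Real.sq_sqrt (by linarith)
  have hs8 : 8 ≤ √L := Real.le_sqrt_of_sq_le (by linarith)
  have hδ : L * (1 / (8 * √L)) ^ 2 = 1 / 64 := by
    rw [← hs, Real.sqrt_sq (by linarith)]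
    field_simp
    norm_num
  have hδ' : 1 / (8 * √L) ≤ 1 / 64 := by
    apply one_div_le_one_div_of_le <;> linarith
  set T := jacobiTheta₂ (L * a - I * (L * θ)) (I * L)
  have hT : ‖T - 1‖ ≤ 1 / 10 := by
    have him : (I * (L : ℂ)).im = L := by simp
    have hzim : |((L : ℂ) * a - I * (L * θ)).im| ≤ L / 4 := by
      have : ((L : ℂ) * a - I * (L * θ)).im = -(L * θ) := by simp
      rw [this, abs_neg, abs_mul, abs_of_pos (by linarith : 0 < L)]
      nlinarith
    have hb := norm_jacobiTheta₂_sub_one_le (z := L * a - I * (L * θ)) (τ := I * L)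
      (by rw [him]; linarith) (by rw [him]; exact hzim)
    rw [him] at hb
    refine hb.trans ?_
    have hr : rexp (-(π * L / 2)) ≤ 1 / 97 := by
      rw [Real.exp_neg, ← one_div]
      apply one_div_le_one_div_of_le (by norm_num)
      have := Real.add_one_le_exp (π * L / 2)
      nlinarith [pi_gt_three]
    rw [div_le_iff₀ (by linarith)]
    linarith
  set x : ℂ := -(π * L * θ ^ 2) - 2 * π * I * L * θ * a
  have hx : ‖x‖ ≤ 3 / 20 := by
    have h1 : ‖(π * L * θ ^ 2 : ℂ)‖ ≤ π * (1 / 64) := by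
      rw [← hδ]
      simp only [norm_mul, norm_pow, norm_real, Real.norm_eq_abs, abs_of_pos pi_pos,
        abs_of_pos (by linarith : 0 < L), mul_assoc]
      gcongr
    have h2 : ‖(2 * π * I * L * θ * a : ℂ)‖ ≤ 2 * π * (1 / 64) := by
      rw [← hδ]
      simp only [norm_mul, norm_real, Real.norm_eq_abs, abs_of_pos pi_pos, norm_I,
        Complex.norm_two, one_mul, abs_of_pos (by linarith : 0 < L), mul_assoc, sq]
      gcongr
    have h3 : ‖x‖ ≤ _ := norm_sub_le _ _
    rw [norm_neg] at h3
    linarith [pi_lt_d2]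
  have hE : ‖cexp x - 1‖ ≤ 3 / 10 := by
    have := Complex.norm_exp_sub_one_le (x := x) (by linarith)
    linarith
  have hE' : ‖cexp x‖ ≤ 13 / 10 := by
    have := norm_add_le (cexp x - 1) 1
    simp only [sub_add_cancel, norm_one] at this
    linarith
  have hw : ‖cexp x * T - 1‖ ≤ 1 / 2 := by
    have : cexp x * T - 1 = cexp x * (T - 1) + (cexp x - 1) := by ring
    rw [this]
    refine (norm_add_le _ _).trans ?_
    rw [norm_mul]
    nlinarith [norm_nonneg (T - 1), norm_nonneg (cexp x)]
  have := (abs_le.1 ((Complex.abs_re_le_norm (cexp x * T - 1)).trans hw)).1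
  simp only [sub_re, one_re] at this
  linarith

lemma continuous_hBWZ_zero (lam : ℕ) (hlam : 0 < lam) (q : ℤ) :
    Continuous (hBWZ lam q 0) := by
  have hθ : Continuous fun z : ℂ ↦ jacobiTheta₂ z (I / lam) :=
    continuous_iff_continuousAt.2 fun z ↦ (differentiableAt_jacobiTheta₂_fst z (by
      have : I / (lam : ℂ) = ((lam : ℝ)⁻¹ : ℝ) * I := by push_cast; ring
      rw [this, im_ofReal_mul, I_im, mul_one]
      positivity)).continuousAt
  have : hBWZ lam q 0 = fun x : ℝ × ℝ × ℝ ↦ _ :=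
    funext fun x ↦ hBWZ_zero_eq_jacobiTheta₂ lam hlam q x.1 x.2.1 x.2.2
  rw [this]
  fun_prop

/-- Lower bound for an iterated integral over `[0,1]²` by the contribution of a corner box. -/
lemma le_integral_integral_of_le_on_box {f : ℝ → ℝ → ℝ} (hf : Continuous f.uncurry)
    (hf0 : ∀ a b, 0 ≤ f a b) {δ m : ℝ} (hδ0 : 0 ≤ δ) (hδ1 : δ ≤ 1)
    (hm : ∀ a ∈ Set.Icc 0 δ, ∀ b ∈ Set.Icc 0 δ, m ≤ f a b) :
    δ * (δ * m) ≤ ∫ a in Set.Icc (0 : ℝ) 1, ∫ b in Set.Icc (0 : ℝ) 1, f a b := by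
  have box : ∀ (g : ℝ → ℝ) (m : ℝ), Continuous g → (∀ x, 0 ≤ g x) →
      (∀ x ∈ Set.Icc 0 δ, m ≤ g x) → δ * m ≤ ∫ x in Set.Icc (0 : ℝ) 1, g x := by
    intro g m hg hg0 hgm
    calc δ * m = ∫ _ in Set.Icc (0 : ℝ) δ, m := by simp [hδ0]
      _ ≤ ∫ x in Set.Icc (0 : ℝ) δ, g x :=
        setIntegral_mono_on (by simp) hg.continuousOn.integrableOn_Icc measurableSet_Icc hgm
      _ ≤ ∫ x in Set.Icc (0 : ℝ) 1, g x :=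
        setIntegral_mono_set hg.continuousOn.integrableOn_Icc
          (Filter.Eventually.of_forall hg0) (Set.Icc_subset_Icc_right hδ1).eventuallyLE
  refine box _ _ (continuous_parametric_integral_of_continuous hf isCompact_Icc)
    (fun a ↦ integral_nonneg (hf0 a)) fun a ha ↦ ?_
  exact box _ _ (hf.comp (by fun_prop : Continuous fun b ↦ (a, b))) (hf0 a) (hm a ha)

/-- The norm of a superposition of ground states with coefficients `1` on a block of length at
most `√λ / 8`. -/
lemma norm_sum_hBWZ_ge {lam : ℕ} (hlam : 64 ≤ lam) (s : Finset (ZMod lam))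
    (hs : ∀ q ∈ s, (q.val : ℝ) ≤ √(lam : ℝ) / 8) {a b : ℝ} (c : ℝ)
    (ha : a ∈ Set.Icc 0 (1 / (8 * √(lam : ℝ)))) (hb : b ∈ Set.Icc 0 (1 / (8 * √(lam : ℝ)))) :
    (2 * lam) * (s.card / 2 : ℝ) ^ 4 ≤ ‖∑ q ∈ s, hBWZ lam (q.val : ℤ) 0 (a, b, c)‖ ^ 4 := by
  have hL : (64 : ℝ) ≤ lam := by exact_mod_cast hlam
  have hsq : √(lam : ℝ) * √(lam : ℝ) = lam := Real.mul_self_sqrt (by positivity)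
  have hs0 : 0 < √(lam : ℝ) := Real.sqrt_pos.2 (by linarith)
  rw [Finset.sum_congr rfl fun q _ ↦ hBWZ_zero_eq_wave_packet lam (by lia) (q.val : ℤ) a b c,
    ← Finset.mul_sum, norm_mul, norm_mul, mul_pow, mul_pow, norm_real, Real.norm_eq_abs,
    abs_of_nonneg (by positivity), gaussian_const_pow_four (Nat.cast_nonneg lam)]
  have hph : ‖cexp (2 * π * I * (lam * c))‖ = 1 := by
    rw [show (2 * π * I * (lam * c) : ℂ) = ((2 * π * (lam * c) : ℝ) : ℂ) * I by push_cast; ring,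
      norm_exp_ofReal_mul_I]
  rw [hph, one_pow, mul_one]
  gcongr
  refine le_trans ?_ (Complex.re_le_norm _)
  rw [Complex.re_sum, div_eq_mul_one_div, ← nsmul_eq_mul]
  refine Finset.card_nsmul_le_sum _ _ _ fun q hq ↦ ?_
  have hq1 : (q.val : ℝ) / lam ≤ 1 / (8 * √(lam : ℝ)) := by
    rw [div_le_div_iff₀ (by positivity) (by positivity)]
    nlinarith [hs q hq]
  have hq0 : 0 ≤ (q.val : ℝ) / lam := by positivity
  have := re_wave_packet_ge (L := lam) (θ := b - q.val / lam) (a := a) hL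
    (abs_le.2 ⟨by linarith [hb.1], by linarith [hb.2]⟩)
    (by rw [abs_of_nonneg ha.1]; exact ha.2)
  push_cast at this ⊢
  exact this

/-- **Sharpness of the restriction estimate**: there are `C > 0` and `λ₀` such that for
every `λ ≥ λ₀` some nonzero family `γ : ℤ/λℤ → ℂ` satisfies
`‖∑_q γ(q) h_{λ,q,0}‖⁴_{L⁴([0,1]³)} ≥ C λ (∑_q |γ(q)|²)²`. -/
theorem restriction_sharpness :
    ∃ C > (0 : ℝ), ∃ lam₀ : ℕ, ∀ lam : ℕ, lam₀ ≤ lam →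
      ∃ γ : ZMod lam → ℂ, γ ≠ 0 ∧
        C * (lam : ℝ) * (∑' q : ZMod lam, ‖γ q‖ ^ 2) ^ 2
          ≤ ∫ a in Set.Icc (0:ℝ) 1, ∫ b in Set.Icc (0:ℝ) 1, ∫ c in Set.Icc (0:ℝ) 1,
              ‖∑' q : ZMod lam, γ q * hBWZ (lam : ℤ) (q.val : ℤ) 0 (a, b, c)‖ ^ 4 := by
  refine ⟨1 / (512 * 256), by norm_num, 64, fun lam hlam ↦ ?_⟩
  have : NeZero lam := ⟨by lia⟩
  have hL : (64 : ℝ) ≤ lam := by exact_mod_cast hlam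
  have hsq : √(lam : ℝ) ^ 2 = lam := Real.sq_sqrt (by positivity)
  have hs8 : 8 ≤ √(lam : ℝ) := Real.le_sqrt_of_sq_le (by linarith)
  set M : ℕ := ⌊√(lam : ℝ) / 8⌋₊
  have hMle : (M : ℝ) ≤ √(lam : ℝ) / 8 := Nat.floor_le (by positivity)
  have hM1 : 1 ≤ M := Nat.le_floor (by push_cast; linarith)
  have hMge : √(lam : ℝ) / 16 ≤ M := by
    have h1 := Nat.lt_floor_add_one (√(lam : ℝ) / 8)
    have h2 : (1 : ℝ) ≤ M := by exact_mod_cast hM1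
    linarith
  have hMlam : M ≤ lam := by
    have : (M : ℝ) ≤ lam := by nlinarith
    exact_mod_cast this
  set s : Finset (ZMod lam) := Finset.univ.filter fun q ↦ q.val < M with hsdef
  have hcard : M ≤ s.card := by
    rw [← Finset.card_range M]
    refine Finset.card_le_card_of_injOn (fun n ↦ (n : ZMod lam)) (fun n hn ↦ ?_)
      fun n hn m hm h ↦ ?_
    · have hn' : n < M := by simpa using hn
      simpa [hsdef, ZMod.val_natCast_of_lt (hn'.trans_le hMlam)] using hn'
    · have hn' : n < M := by simpa using hn
      have hm' : m < M := by simpa using hm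
      have := congrArg ZMod.val h
      simpa [ZMod.val_natCast_of_lt (hn'.trans_le hMlam),
        ZMod.val_natCast_of_lt (hm'.trans_le hMlam)] using this
  have hsval : ∀ q ∈ s, (q.val : ℝ) ≤ √(lam : ℝ) / 8 := fun q hq ↦ by
    have h1 : q.val < M := (Finset.mem_filter.1 hq).2
    have h2 : (q.val : ℝ) ≤ M := by exact_mod_cast h1.le
    linarith
  refine ⟨fun q ↦ if q ∈ s then 1 else 0, fun h ↦ ?_, ?_⟩
  · have h0 : (0 : ZMod lam) ∈ s := by
      simp only [hsdef, Finset.mem_filter, Finset.mem_univ, true_and, ZMod.val_zero]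
      lia
    simpa [h0] using congrFun h 0
  have hl2 : ∑' q : ZMod lam, ‖(if q ∈ s then 1 else 0 : ℂ)‖ ^ 2 = s.card := by
    rw [tsum_fintype]
    simp [apply_ite]
  have hF : ∀ x : ℝ × ℝ × ℝ,
      ∑' q : ZMod lam, (if q ∈ s then 1 else 0 : ℂ) * hBWZ (lam : ℤ) (q.val : ℤ) 0 x =
        ∑ q ∈ s, hBWZ lam (q.val : ℤ) 0 x := fun x ↦ by
    rw [tsum_fintype]
    simp
  simp only [hl2, hF]
  have hcont : Continuous fun x : ℝ × ℝ × ℝ ↦ ‖∑ q ∈ s, hBWZ lam (q.val : ℤ) 0 x‖ ^ 4 :=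
    ((continuous_finsetSum s fun q _ ↦
      continuous_hBWZ_zero lam (by lia) (q.val : ℤ)).norm.pow 4)
  have hlow := le_integral_integral_of_le_on_box
    (f := fun a b ↦ ∫ c in Set.Icc (0 : ℝ) 1, ‖∑ q ∈ s, hBWZ lam (q.val : ℤ) 0 (a, b, c)‖ ^ 4)
    (δ := 1 / (8 * √(lam : ℝ))) (m := (2 * lam) * (s.card / 2 : ℝ) ^ 4)
    (continuous_parametric_integral_of_continuous
      (f := fun (p : ℝ × ℝ) c ↦ ‖∑ q ∈ s, hBWZ lam (q.val : ℤ) 0 (p.1, p.2, c)‖ ^ 4)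
      (hcont.comp (by fun_prop : Continuous fun p : (ℝ × ℝ) × ℝ ↦ (p.1.1, p.1.2, p.2)))
      isCompact_Icc)
    (fun a b ↦ integral_nonneg fun c ↦ by positivity) (by positivity)
    ((div_le_one (by positivity)).2 (by linarith))
    (fun a ha b hb ↦ by
      calc (2 * lam) * (s.card / 2 : ℝ) ^ 4
          = ∫ _ in Set.Icc (0 : ℝ) 1, (2 * lam) * (s.card / 2 : ℝ) ^ 4 := by simp
        _ ≤ ∫ c in Set.Icc (0 : ℝ) 1, ‖∑ q ∈ s, hBWZ lam (q.val : ℤ) 0 (a, b, c)‖ ^ 4 :=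
          setIntegral_mono_on (continuous_const.continuousOn.integrableOn_Icc)
            (hcont.comp (by fun_prop : Continuous fun c ↦ (a, b, c))).continuousOn.integrableOn_Icc
            measurableSet_Icc fun c _ ↦ norm_sum_hBWZ_ge hlam s hsval c ha hb)
  refine le_trans ?_ hlow
  have hN : √(lam : ℝ) / 16 ≤ s.card := hMge.trans (by exact_mod_cast hcard)
  have hN2 : (lam : ℝ) / 256 ≤ (s.card : ℝ) ^ 2 := by
    have := pow_le_pow_left₀ (by positivity) hN 2
    rw [div_pow, hsq] at this
    norm_num at this
    exact this
  have hR : 1 / (8 * √(lam : ℝ)) * (1 / (8 * √(lam : ℝ)) * ((2 * lam) * (s.card / 2 : ℝ) ^ 4)) =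
      (s.card : ℝ) ^ 2 * (s.card : ℝ) ^ 2 / 512 := by
    nth_rw 3 [← hsq]
    field_simp
    ring
  rw [hR]
  have := mul_le_mul_of_nonneg_right hN2 (sq_nonneg (s.card : ℝ))
  linarith
end
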